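/- Let f(x,y) = −53y² − 31xy + 59x² − 79y³ + 82xy² − 52x²y + 22x³ + 75y⁴ − 27xy³ + 63x²y² − 85x³y − 89x⁴ + 80y⁵ + 27xy⁴ − 69x²y³ + 17x³y² − 7x⁴y − 43x⁵ − 25y⁶ + 17xy⁵ + 27x²y⁴ − 55x³y³ − 37x⁴y² + 59x⁵y + 45x⁶. Then the hessian curve Z = {(x,y) ∈ ℝ² : Hess(f)(x,y) = 0} has exactly 13 connected components, of which exactly 11 are bounded subsets of ℝ² (ovals) and exactly 2 are unbounded. -/

import Mathlib

open MvPolynomial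

/-- The hessian determinant of a polynomial in two variables over the reals:
`Hess f = f_xx * f_yy - f_xy ^ 2` (with formal partial derivatives). -/
noncomputable def Hess (f : MvPolynomial (Fin 2) ℝ) : MvPolynomial (Fin 2) ℝ :=
  pderiv 0 (pderiv 0 f) * pderiv 1 (pderiv 1 f) - (pderiv 0 (pderiv 1 f)) ^ 2

/-- The set of connected components of a set `Z ⊆ ℝ × ℝ` (with its subspace
topology), viewed as subsets of `ℝ × ℝ`. -/
def components (Z : Set (ℝ × ℝ)) : Set (Set (ℝ × ℝ)) :=
  {C | ∃ p ∈ Z, C = connectedComponentIn Z p}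

/-- The polynomial `f` of the statement. -/
noncomputable def f : MvPolynomial (Fin 2) ℝ :=
  -53 * (X 1)^2 - 31 * (X 0)*(X 1) + 59 * (X 0)^2 - 79 * (X 1)^3 + 82 * (X 0)*(X 1)^2 - 52 * (X 0)^2*(X 1) + 22 * (X 0)^3 + 75 * (X 1)^4 - 27 * (X 0)*(X 1)^3 + 63 * (X 0)^2*(X 1)^2 - 85 * (X 0)^3*(X 1) - 89 * (X 0)^4 + 80 * (X 1)^5 + 27 * (X 0)*(X 1)^4 - 69 * (X 0)^2*(X 1)^3 + 17 * (X 0)^3*(X 1)^2 - 7 * (X 0)^4*(X 1) - 43 * (X 0)^5 - 25 * (X 1)^6 + 17 * (X 0)*(X 1)^5 + 27 * (X 0)^2*(X 1)^4 - 55 * (X 0)^3*(X 1)^3 - 37 * (X 0)^4*(X 1)^2 + 59 * (X 0)^5*(X 1) + 45 * (X 0)^6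

/-- The hessian curve of `f` in `ℝ²`. -/
noncomputable def Z : Set (ℝ × ℝ) := {p | eval ![p.1, p.2] (Hess f) = 0}

/-- Nine Bernstein coefficients of a polynomial of degree at most eight. -/
structure V (α : Type) where
  (x0 x1 x2 x3 x4 x5 x6 x7 x8 : α)

namespace V

variable {α β : Type}

def map (φ : α → β) (v : V α) : V β :=
  ⟨φ v.x0, φ v.x1, φ v.x2, φ v.x3, φ v.x4, φ v.x5, φ v.x6, φ v.x7, φ v.x8⟩

def zip (φ : α → α → α) (v w : V α) : V α :=
  ⟨φ v.x0 w.x0, φ v.x1 w.x1, φ v.x2 w.x2, φ v.x3 w.x3, φ v.x4 w.x4, φ v.x5 w.x5,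
    φ v.x6 w.x6, φ v.x7 w.x7, φ v.x8 w.x8⟩

def all (φ : α → Bool) (v : V α) : Bool :=
  φ v.x0 && φ v.x1 && φ v.x2 && φ v.x3 && φ v.x4 && φ v.x5 && φ v.x6 && φ v.x7 && φ v.x8

def chain (φ : α → α → Bool) (v : V α) : Bool :=
  φ v.x0 v.x1 && φ v.x1 v.x2 && φ v.x2 v.x3 && φ v.x3 v.x4 && φ v.x4 v.x5 && φ v.x5 v.x6 &&
    φ v.x6 v.x7 && φ v.x7 v.x8

/-- De Casteljau subdivision at the midpoint: the Bernstein coefficients on both halves,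
multiplied by `2 ^ 8`. -/
def split (plus : α → α → α) (mul : ℕ → α → α) (v : V α) : V α × V α :=
  let a0 := plus v.x0 v.x1
  let a1 := plus v.x1 v.x2
  let a2 := plus v.x2 v.x3
  let a3 := plus v.x3 v.x4
  let a4 := plus v.x4 v.x5
  let a5 := plus v.x5 v.x6
  let a6 := plus v.x6 v.x7
  let a7 := plus v.x7 v.x8
  let b0 := plus a0 a1
  let b1 := plus a1 a2
  let b2 := plus a2 a3
  let b3 := plus a3 a4
  let b4 := plus a4 a5
  let b5 := plus a5 a6
  let b6 := plus a6 a7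
  let c0 := plus b0 b1
  let c1 := plus b1 b2
  let c2 := plus b2 b3
  let c3 := plus b3 b4
  let c4 := plus b4 b5
  let c5 := plus b5 b6
  let d0 := plus c0 c1
  let d1 := plus c1 c2
  let d2 := plus c2 c3
  let d3 := plus c3 c4
  let d4 := plus c4 c5
  let e0 := plus d0 d1
  let e1 := plus d1 d2
  let e2 := plus d2 d3
  let e3 := plus d3 d4
  let f0 := plus e0 e1
  let f1 := plus e1 e2
  let f2 := plus e2 e3
  let g0 := plus f0 f1
  let g1 := plus f1 f2
  let h0 := plus g0 g1
  (⟨mul 256 v.x0, mul 128 a0, mul 64 b0, mul 32 c0, mul 16 d0, mul 8 e0, mul 4 f0, mul 2 g0, h0⟩,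
    ⟨h0, mul 2 g1, mul 4 f2, mul 8 e3, mul 16 d4, mul 32 c5, mul 64 b6, mul 128 a7,
      mul 256 v.x8⟩)

/-- The polynomial with given Bernstein coefficients. -/
noncomputable def bern (v : V ℝ) (t : ℝ) : ℝ :=
  v.x0 * (1 - t) ^ 8 + 8 * v.x1 * t * (1 - t) ^ 7 + 28 * v.x2 * t ^ 2 * (1 - t) ^ 6 +
    56 * v.x3 * t ^ 3 * (1 - t) ^ 5 + 70 * v.x4 * t ^ 4 * (1 - t) ^ 4 +
    56 * v.x5 * t ^ 5 * (1 - t) ^ 3 + 28 * v.x6 * t ^ 6 * (1 - t) ^ 2 +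
    8 * v.x7 * t ^ 7 * (1 - t) + v.x8 * t ^ 8

theorem bern_split_fst {plus : α → α → α} {mul : ℕ → α → α} {φ : α → ℝ}
    (hplus : ∀ a b, φ (plus a b) = φ a + φ b) (hmul : ∀ n a, φ (mul n a) = n * φ a)
    (v : V α) (t : ℝ) :
    bern ((v.split plus mul).1.map φ) t = 256 * bern (v.map φ) (t / 2) := by
  simp only [bern, split, map, hplus, hmul]
  push_cast
  ring

theorem bern_split_snd {plus : α → α → α} {mul : ℕ → α → α} {φ : α → ℝ}
    (hplus : ∀ a b, φ (plus a b) = φ a + φ b) (hmul : ∀ n a, φ (mul n a) = n * φ a)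
    (v : V α) (t : ℝ) :
    bern ((v.split plus mul).2.map φ) t = 256 * bern (v.map φ) ((1 + t) / 2) := by
  simp only [bern, split, map, hplus, hmul]
  push_cast
  ring

theorem bern_zip_add (v w : V ℕ) (t : ℝ) :
    bern ((zip Nat.add v w).map (↑)) t = bern (v.map (↑)) t + bern (w.map (↑)) t := by
  simp only [bern, zip, map, Nat.add_eq, Nat.cast_add]
  ring

theorem bern_map_mul (n : ℕ) (v : V ℕ) (t : ℝ) :
    bern ((v.map (Nat.mul n)).map (↑)) t = n * bern (v.map (↑)) t := by
  simp only [bern, map, Nat.mul_eq, Nat.cast_mul]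
  ring

end V

/-- The polynomial in two variables with given tensor Bernstein coefficients. -/
noncomputable def bern₂ (q : V (V ℕ)) (s t : ℝ) : ℝ :=
  (q.map fun r => (r.map (Nat.cast : ℕ → ℝ)).bern t).bern s

/-- Subdivision in the first variable. -/
def splitS (q : V (V ℕ)) : V (V ℕ) × V (V ℕ) :=
  q.split (V.zip Nat.add) fun n => V.map (Nat.mul n)

/-- Subdivision in the second variable. -/
def splitT (q : V (V ℕ)) : V (V ℕ) × V (V ℕ) :=
  (q.map fun r => (r.split Nat.add Nat.mul).1, q.map fun r => (r.split Nat.add Nat.mul).2)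

theorem bern₂_splitS_fst (q : V (V ℕ)) (s t : ℝ) :
    bern₂ (splitS q).1 s t = 256 * bern₂ q (s / 2) t :=
  V.bern_split_fst (fun a b => V.bern_zip_add a b t) (fun n a => V.bern_map_mul n a t) q s

theorem bern₂_splitS_snd (q : V (V ℕ)) (s t : ℝ) :
    bern₂ (splitS q).2 s t = 256 * bern₂ q ((1 + s) / 2) t :=
  V.bern_split_snd (fun a b => V.bern_zip_add a b t) (fun n a => V.bern_map_mul n a t) q s

theorem bern₂_splitT_fst (q : V (V ℕ)) (s t : ℝ) :
    bern₂ (splitT q).1 s t = 256 * bern₂ q s (t / 2) := by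
  have h (r : V ℕ) := V.bern_split_fst (φ := (Nat.cast : ℕ → ℝ)) (plus := Nat.add) (mul := Nat.mul)
    (fun a b => Nat.cast_add a b) (fun a b => Nat.cast_mul a b) r t
  simp only [bern₂, splitT, V.map] at h ⊢
  simp only [h]
  simp only [V.bern]
  ring

theorem bern₂_splitT_snd (q : V (V ℕ)) (s t : ℝ) :
    bern₂ (splitT q).2 s t = 256 * bern₂ q s ((1 + t) / 2) := by
  have h (r : V ℕ) := V.bern_split_snd (φ := (Nat.cast : ℕ → ℝ)) (plus := Nat.add) (mul := Nat.mul)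
    (fun a b => Nat.cast_add a b) (fun a b => Nat.cast_mul a b) r t
  simp only [bern₂, splitT, V.map] at h ⊢
  simp only [h]
  simp only [V.bern]
  ring

/-- The grid cell `[a / N, b / N] × [c / N, d / N]` of the chart `ch`, where `N = 2048`. -/
structure Cell where
  (ch a b c d : ℕ)

namespace V

def pos (M : ℕ) (v : V ℕ) : Bool := v.all (Nat.blt M)

def neg (M : ℕ) (v : V ℕ) : Bool := v.all fun x => Nat.blt x M

def incr (v : V ℕ) : Bool := v.chain Nat.blt

def decr (v : V ℕ) : Bool := v.chain fun x y => Nat.blt y x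

/-- The differences of consecutive coefficients form a chain for `φ`. -/
def chain₂ (φ : ℕ → ℕ → Bool) (v : V ℕ) : Bool :=
  φ (v.x1 + v.x1) (v.x0 + v.x2) && φ (v.x2 + v.x2) (v.x1 + v.x3) &&
    φ (v.x3 + v.x3) (v.x2 + v.x4) && φ (v.x4 + v.x4) (v.x3 + v.x5) &&
    φ (v.x5 + v.x5) (v.x4 + v.x6) && φ (v.x6 + v.x6) (v.x5 + v.x7) &&
    φ (v.x7 + v.x7) (v.x6 + v.x8)

def conv (v : V ℕ) : Bool := v.chain₂ Nat.ble

def conc (v : V ℕ) : Bool := v.chain₂ fun x y => Nat.ble y x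

/-- A sufficient condition for the sublevel set of `M` in `[0, 1]` to be an interval. -/
def sublevel (M : ℕ) (v : V ℕ) : Bool := v.pos M || v.neg M || v.incr || v.decr || v.conv

/-- A sufficient condition for the superlevel set of `M` in `[0, 1]` to be an interval. -/
def suplevel (M : ℕ) (v : V ℕ) : Bool := v.pos M || v.neg M || v.incr || v.decr || v.conc

/-- Componentwise strict inequality. -/
def ltAll (v w : V ℕ) : Bool :=
  Nat.blt v.x0 w.x0 && Nat.blt v.x1 w.x1 && Nat.blt v.x2 w.x2 && Nat.blt v.x3 w.x3 &&
    Nat.blt v.x4 w.x4 && Nat.blt v.x5 w.x5 && Nat.blt v.x6 w.x6 && Nat.blt v.x7 w.x7 &&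
    Nat.blt v.x8 w.x8

end V

def nonvanishing (M : ℕ) (q : V (V ℕ)) : Bool := q.all (V.pos M) || q.all (V.neg M)

def graphT (M : ℕ) (q : V (V ℕ)) : Bool :=
  q.all V.incr && (q.map V.x0).sublevel M && (q.map V.x8).suplevel M ||
    q.all V.decr && (q.map V.x0).suplevel M && (q.map V.x8).sublevel M

def graphS (M : ℕ) (q : V (V ℕ)) : Bool :=
  q.chain V.ltAll && q.x0.sublevel M && q.x8.suplevel M ||
    q.chain (fun v w => w.ltAll v) && q.x0.suplevel M && q.x8.sublevel M

def graph (M : ℕ) (q : V (V ℕ)) (ch a : ℕ) : Bool :=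
  graphT M q || (Nat.beq ch 0 || Nat.blt 0 a) && graphS M q

def Cell.beq (k l : Cell) : Bool :=
  Nat.beq k.ch l.ch && Nat.beq k.a l.a && Nat.beq k.b l.b && Nat.beq k.c l.c && Nat.beq k.d l.d

/-- Subdivide the cell `k`, on which the chart polynomial plus `M` has Bernstein coefficients `q`,
down to the cells of the list and cells without zeros. -/
def cover : ℕ → V (V ℕ) → ℕ → Cell → List Cell → Bool
  | 0, _, _, _, _ => false
  | n + 1, q, M, k, L =>
    (L.isEmpty && nonvanishing M q) ||
    (!L.isEmpty && L.all k.beq && graph M q k.ch k.a) ||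
    bif Nat.ble (k.d - k.c) (k.b - k.a) then
      let m := (k.a + k.b) / 2
      Nat.beq (m + m) (k.a + k.b) &&
      cover n (splitS q).1 (256 * M) ⟨k.ch, k.a, m, k.c, k.d⟩ (L.filter fun l => Nat.ble l.b m) &&
      cover n (splitS q).2 (256 * M) ⟨k.ch, m, k.b, k.c, k.d⟩ (L.filter fun l => !Nat.ble l.b m)
    else
      let m := (k.c + k.d) / 2
      Nat.beq (m + m) (k.c + k.d) &&
      cover n (splitT q).1 (256 * M) ⟨k.ch, k.a, k.b, k.c, m⟩ (L.filter fun l => Nat.ble l.d m) &&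
      cover n (splitT q).2 (256 * M) ⟨k.ch, k.a, k.b, m, k.d⟩ (L.filter fun l => !Nat.ble l.d m)

/-- A point of the plane with homogeneous coordinates `[X : Y : W]`. -/
structure Pt where
  (X Y W : ℤ)

/-- A cell together with two points, joined by a segment that lies in this cell and in the next
one and crosses the curve. -/
structure Link where
  (cell : Cell)
  (P Q : Pt)

namespace V

theorem bern_lt_bern {v w : V ℝ} {t : ℝ} (ht : t ∈ Set.Icc (0 : ℝ) 1)
    (h0 : v.x0 < w.x0) (h1 : v.x1 < w.x1) (h2 : v.x2 < w.x2) (h3 : v.x3 < w.x3)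
    (h4 : v.x4 < w.x4) (h5 : v.x5 < w.x5) (h6 : v.x6 < w.x6) (h7 : v.x7 < w.x7)
    (h8 : v.x8 < w.x8) : bern v t < bern w t := by
  obtain ⟨ht0, ht1⟩ := ht
  have hu : 0 ≤ 1 - t := sub_nonneg.2 ht1
  have hd (i j : ℕ) {c x y : ℝ} (hc : 0 ≤ c) (h : x < y) :
      0 ≤ c * (y - x) * t ^ i * (1 - t) ^ j := by
    have := sub_pos.2 h
    positivity
  have e1 := hd 1 7 (c := 8) (by norm_num) h1
  have e2 := hd 2 6 (c := 28) (by norm_num) h2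
  have e3 := hd 3 5 (c := 56) (by norm_num) h3
  have e4 := hd 4 4 (c := 70) (by norm_num) h4
  have e5 := hd 5 3 (c := 56) (by norm_num) h5
  have e6 := hd 6 2 (c := 28) (by norm_num) h6
  have e7 := hd 7 1 (c := 8) (by norm_num) h7
  have e : 0 < (w.x0 - v.x0) * (1 - t) ^ 8 + (w.x8 - v.x8) * t ^ 8 := by
    have p0 := sub_pos.2 h0
    have p8 := sub_pos.2 h8
    rcases ht0.eq_or_lt with rfl | ht0
    · simpa using h0
    · positivity
  simp only [bern]
  linarith

/-- The derivative of `bern`. -/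
noncomputable def bern' (v : V ℝ) (t : ℝ) : ℝ :=
  8 * ((v.x1 - v.x0) * (1 - t) ^ 7 + 7 * (v.x2 - v.x1) * t * (1 - t) ^ 6 +
    21 * (v.x3 - v.x2) * t ^ 2 * (1 - t) ^ 5 + 35 * (v.x4 - v.x3) * t ^ 3 * (1 - t) ^ 4 +
    35 * (v.x5 - v.x4) * t ^ 4 * (1 - t) ^ 3 + 21 * (v.x6 - v.x5) * t ^ 5 * (1 - t) ^ 2 +
    7 * (v.x7 - v.x6) * t ^ 6 * (1 - t) + (v.x8 - v.x7) * t ^ 7)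

/-- The second derivative of `bern`. -/
noncomputable def bern'' (v : V ℝ) (t : ℝ) : ℝ :=
  56 * ((v.x2 - v.x1 - (v.x1 - v.x0)) * (1 - t) ^ 6 +
    6 * (v.x3 - v.x2 - (v.x2 - v.x1)) * t * (1 - t) ^ 5 +
    15 * (v.x4 - v.x3 - (v.x3 - v.x2)) * t ^ 2 * (1 - t) ^ 4 +
    20 * (v.x5 - v.x4 - (v.x4 - v.x3)) * t ^ 3 * (1 - t) ^ 3 +
    15 * (v.x6 - v.x5 - (v.x5 - v.x4)) * t ^ 4 * (1 - t) ^ 2 +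
    6 * (v.x7 - v.x6 - (v.x6 - v.x5)) * t ^ 5 * (1 - t) +
    (v.x8 - v.x7 - (v.x7 - v.x6)) * t ^ 6)

theorem hasDerivAt_monomial (c t : ℝ) (i j : ℕ) :
    HasDerivAt (fun t : ℝ => c * t ^ i * (1 - t) ^ j)
      (c * (i * t ^ (i - 1)) * (1 - t) ^ j - c * t ^ i * (j * (1 - t) ^ (j - 1))) t := by
  have h := ((hasDerivAt_pow i t).const_mul c).mul (((hasDerivAt_id t).const_sub 1).pow j)
  refine h.congr_deriv ?_
  simp only [id, Pi.pow_apply]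
  ring

theorem hasDerivAt_bern (v : V ℝ) (t : ℝ) : HasDerivAt v.bern (v.bern' t) t := by
  have h := ((((((((hasDerivAt_monomial v.x0 t 0 8).add (hasDerivAt_monomial (8 * v.x1) t 1 7)).add
    (hasDerivAt_monomial (28 * v.x2) t 2 6)).add (hasDerivAt_monomial (56 * v.x3) t 3 5)).add
    (hasDerivAt_monomial (70 * v.x4) t 4 4)).add (hasDerivAt_monomial (56 * v.x5) t 5 3)).add
    (hasDerivAt_monomial (28 * v.x6) t 6 2)).add (hasDerivAt_monomial (8 * v.x7) t 7 1)).add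
    (hasDerivAt_monomial v.x8 t 8 0)
  refine (h.congr_deriv ?_).congr_of_eventuallyEq (.of_forall fun s => ?_)
  · simp only [bern']
    norm_num
    ring
  · simp [bern]

theorem hasDerivAt_bern' (v : V ℝ) (t : ℝ) : HasDerivAt v.bern' (v.bern'' t) t := by
  have h := (((((((hasDerivAt_monomial (v.x1 - v.x0) t 0 7).add
    (hasDerivAt_monomial (7 * (v.x2 - v.x1)) t 1 6)).add
    (hasDerivAt_monomial (21 * (v.x3 - v.x2)) t 2 5)).add
    (hasDerivAt_monomial (35 * (v.x4 - v.x3)) t 3 4)).add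
    (hasDerivAt_monomial (35 * (v.x5 - v.x4)) t 4 3)).add
    (hasDerivAt_monomial (21 * (v.x6 - v.x5)) t 5 2)).add
    (hasDerivAt_monomial (7 * (v.x7 - v.x6)) t 6 1)).add
    (hasDerivAt_monomial (v.x8 - v.x7) t 7 0)
  refine ((h.const_mul 8).congr_deriv ?_).congr_of_eventuallyEq (.of_forall fun s => ?_)
  · simp only [bern'']
    norm_num
    ring
  · simp [bern']

theorem continuous_bern (v : V ℝ) : Continuous v.bern := by
  unfold bern
  fun_prop

theorem bern_strictMonoOn {v : V ℝ}
    (h0 : v.x0 < v.x1) (h1 : v.x1 < v.x2) (h2 : v.x2 < v.x3) (h3 : v.x3 < v.x4)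
    (h4 : v.x4 < v.x5) (h5 : v.x5 < v.x6) (h6 : v.x6 < v.x7) (h7 : v.x7 < v.x8) :
    StrictMonoOn v.bern (Set.Icc 0 1) := by
  refine strictMonoOn_of_deriv_pos (convex_Icc 0 1) v.continuous_bern.continuousOn fun t ht => ?_
  rw [interior_Icc] at ht
  rw [(v.hasDerivAt_bern t).deriv, bern']
  have := ht.1
  have := sub_pos.2 ht.2
  have := sub_pos.2 h0
  have := sub_pos.2 h1
  have := sub_pos.2 h2
  have := sub_pos.2 h3
  have := sub_pos.2 h4
  have := sub_pos.2 h5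
  have := sub_pos.2 h6
  have := sub_pos.2 h7
  positivity

theorem bern_convexOn {v : V ℝ}
    (h1 : v.x1 + v.x1 ≤ v.x0 + v.x2) (h2 : v.x2 + v.x2 ≤ v.x1 + v.x3)
    (h3 : v.x3 + v.x3 ≤ v.x2 + v.x4) (h4 : v.x4 + v.x4 ≤ v.x3 + v.x5)
    (h5 : v.x5 + v.x5 ≤ v.x4 + v.x6) (h6 : v.x6 + v.x6 ≤ v.x5 + v.x7)
    (h7 : v.x7 + v.x7 ≤ v.x6 + v.x8) :
    ConvexOn ℝ (Set.Icc 0 1) v.bern := by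
  refine convexOn_of_hasDerivWithinAt2_nonneg (convex_Icc 0 1) v.continuous_bern.continuousOn
    (fun t _ => (v.hasDerivAt_bern t).hasDerivWithinAt)
    (fun t _ => (v.hasDerivAt_bern' t).hasDerivWithinAt) fun t ht => ?_
  rw [interior_Icc] at ht
  have := ht.1
  have := sub_pos.2 ht.2
  have e {x y z : ℝ} (h : y + y ≤ x + z) : 0 ≤ z - y - (y - x) := by linarith
  have := e h1
  have := e h2
  have := e h3
  have := e h4
  have := e h5
  have := e h6
  have := e h7
  rw [bern'']
  positivity

theorem bern_map_neg (v : V ℝ) (t : ℝ) : (v.map Neg.neg).bern t = -v.bern t := by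
  simp only [bern, map]
  ring

theorem bern_zero (v : V ℝ) : v.bern 0 = v.x0 := by simp [bern]

theorem bern_one (v : V ℝ) : v.bern 1 = v.x8 := by simp [bern]

end V

open Set Topology in
/-- The zero set of a function that is increasing in the second variable is connected if the
first coordinates of the zeros form an interval. -/
theorem isPreconnected_zeros_of_strictMonoOn {g : ℝ → ℝ → ℝ} (hg : Continuous (Function.uncurry g))
    (hmono : ∀ σ ∈ Icc (0 : ℝ) 1, StrictMonoOn (g σ) (Icc 0 1))
    (h0 : OrdConnected {σ ∈ Icc (0 : ℝ) 1 | g σ 0 ≤ 0})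
    (h1 : OrdConnected {σ ∈ Icc (0 : ℝ) 1 | 0 ≤ g σ 1})
    {I : Set ℝ} (hI : OrdConnected I) (hI' : I ⊆ Icc 0 1) :
    IsPreconnected {p : ℝ × ℝ | p.1 ∈ I ∧ p.2 ∈ Icc (0 : ℝ) 1 ∧ g p.1 p.2 = 0} := by
  have hg₁ (τ : ℝ) : Continuous fun σ => g σ τ := hg.comp (.prodMk_left τ)
  have hg₂ (σ : ℝ) : Continuous (g σ) := hg.comp (.prodMk_right σ)
  set J := I ∩ {σ ∈ Icc (0 : ℝ) 1 | g σ 0 ≤ 0} ∩ {σ ∈ Icc (0 : ℝ) 1 | 0 ≤ g σ 1} with hJ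
  have hJc : OrdConnected J := (hI.inter h0).inter h1
  have hex : ∀ σ ∈ J, ∃ τ ∈ Icc (0 : ℝ) 1, g σ τ = 0 := fun σ hσ =>
    intermediate_value_Icc zero_le_one (hg₂ σ).continuousOn ⟨hσ.1.2.2, hσ.2.2⟩
  choose! h hh hz using hex
  have hcont : ContinuousOn h J := by
    intro σ hσ
    have hm := hmono σ (hI' hσ.1.1)
    refine tendsto_order.2 ⟨fun a ha => ?_, fun a ha => ?_⟩
    · by_cases ha0 : a < 0
      · filter_upwards [self_mem_nhdsWithin] with x hx using ha0.trans_le (hh x hx).1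
      · have ha' : a ∈ Icc (0 : ℝ) 1 := ⟨not_lt.1 ha0, ha.le.trans (hh σ hσ).2⟩
        have hlt : g σ a < 0 := hz σ hσ ▸ hm ha' (hh σ hσ) ha
        filter_upwards [self_mem_nhdsWithin,
          mem_nhdsWithin_of_mem_nhds ((hg₁ a).continuousAt.eventually_lt_const hlt)] with x hx hxa
        exact ((hmono x (hI' hx.1.1)).lt_iff_lt ha' (hh x hx)).1 (hz x hx ▸ hxa)
    · by_cases ha1 : 1 < a
      · filter_upwards [self_mem_nhdsWithin] with x hx using (hh x hx).2.trans_lt ha1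
      · have ha' : a ∈ Icc (0 : ℝ) 1 := ⟨(hh σ hσ).1.trans ha.le, not_lt.1 ha1⟩
        have hlt : 0 < g σ a := hz σ hσ ▸ hm (hh σ hσ) ha' ha
        filter_upwards [self_mem_nhdsWithin,
          mem_nhdsWithin_of_mem_nhds ((hg₁ a).continuousAt.eventually_const_lt hlt)] with x hx hxa
        exact ((hmono x (hI' hx.1.1)).lt_iff_lt (hh x hx) ha').1 (hz x hx ▸ hxa)
  have himg : {p : ℝ × ℝ | p.1 ∈ I ∧ p.2 ∈ Icc (0 : ℝ) 1 ∧ g p.1 p.2 = 0} =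
      (fun σ => (σ, h σ)) '' J := by
    ext ⟨σ, τ⟩
    simp only [mem_ofPred_eq, mem_image, Prod.mk.injEq]
    constructor
    · rintro ⟨hσ, hτ, h⟩
      have hm := (hmono σ (hI' hσ)).monotoneOn
      have hJσ : σ ∈ J := ⟨⟨hσ, hI' hσ, h ▸ hm (left_mem_Icc.2 zero_le_one) hτ hτ.1⟩,
        hI' hσ, h ▸ hm hτ (right_mem_Icc.2 zero_le_one) hτ.2⟩
      exact ⟨σ, hJσ, rfl, (hmono σ (hI' hσ)).injOn (hh σ hJσ) hτ ((hz σ hJσ).trans h.symm)⟩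
    · rintro ⟨x, hx, rfl, rfl⟩
      exact ⟨hx.1.1, hh x hx, hz x hx⟩
  rw [himg]
  exact hJc.isPreconnected.image _ (continuousOn_id.prodMk hcont)

namespace V

open Set

section

variable {M : ℕ} {v w : V ℕ}

theorem lt_bern_of_pos (h : v.pos M = true) {t : ℝ} (ht : t ∈ Icc (0 : ℝ) 1) :
    M < (v.map (Nat.cast : ℕ → ℝ)).bern t := by
  simp only [pos, all, Bool.and_eq_true, Nat.blt_eq] at h
  have e : (M : ℝ) = bern ⟨M, M, M, M, M, M, M, M, M⟩ t := by simp only [bern]; ring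
  rw [e]
  apply bern_lt_bern ht <;> simp only [map, Nat.cast_lt] <;> tauto

theorem bern_lt_of_neg (h : v.neg M = true) {t : ℝ} (ht : t ∈ Icc (0 : ℝ) 1) :
    (v.map (Nat.cast : ℕ → ℝ)).bern t < M := by
  simp only [neg, all, Bool.and_eq_true, Nat.blt_eq] at h
  have e : (M : ℝ) = bern ⟨M, M, M, M, M, M, M, M, M⟩ t := by simp only [bern]; ring
  rw [e]
  apply bern_lt_bern ht <;> simp only [map, Nat.cast_lt] <;> tauto

theorem strictMonoOn_of_incr (h : v.incr = true) :
    StrictMonoOn (v.map (Nat.cast : ℕ → ℝ)).bern (Icc 0 1) := by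
  simp only [incr, chain, Bool.and_eq_true, Nat.blt_eq] at h
  apply bern_strictMonoOn <;> simp only [map, Nat.cast_lt] <;> tauto

theorem strictAntiOn_of_decr (h : v.decr = true) :
    StrictAntiOn (v.map (Nat.cast : ℕ → ℝ)).bern (Icc 0 1) := by
  simp only [decr, chain, Bool.and_eq_true, Nat.blt_eq] at h
  have : StrictMonoOn ((v.map (Nat.cast : ℕ → ℝ)).map Neg.neg).bern (Icc 0 1) := by
    apply bern_strictMonoOn <;> simp only [map, neg_lt_neg_iff, Nat.cast_lt] <;> tauto
  exact fun x hx y hy hxy => by simpa [bern_map_neg] using this hx hy hxy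

theorem convexOn_of_conv (h : v.conv = true) :
    ConvexOn ℝ (Icc 0 1) (v.map (Nat.cast : ℕ → ℝ)).bern := by
  simp only [conv, chain₂, Bool.and_eq_true, Nat.ble_eq] at h
  apply bern_convexOn <;> simp only [map] <;> norm_cast <;> tauto

theorem concaveOn_of_conc (h : v.conc = true) :
    ConcaveOn ℝ (Icc 0 1) (v.map (Nat.cast : ℕ → ℝ)).bern := by
  simp only [conc, chain₂, Bool.and_eq_true, Nat.ble_eq] at h
  have : ConvexOn ℝ (Icc 0 1) ((v.map (Nat.cast : ℕ → ℝ)).map Neg.neg).bern := by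
    apply bern_convexOn <;> simp only [map, ← neg_add, neg_le_neg_iff] <;> norm_cast <;> tauto
  rw [← neg_convexOn_iff]
  exact this.congr fun t _ => bern_map_neg _ t

theorem bern_lt_of_ltAll (h : v.ltAll w = true) {t : ℝ} (ht : t ∈ Icc (0 : ℝ) 1) :
    (v.map (Nat.cast : ℕ → ℝ)).bern t < (w.map (Nat.cast : ℕ → ℝ)).bern t := by
  simp only [ltAll, Bool.and_eq_true, Nat.blt_eq] at h
  apply bern_lt_bern ht <;> simp only [map, Nat.cast_lt] <;> tauto

theorem ordConnected_of_sublevel (h : v.sublevel M = true) :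
    OrdConnected {t ∈ Icc (0 : ℝ) 1 | (v.map (Nat.cast : ℕ → ℝ)).bern t ≤ M} := by
  simp only [sublevel, Bool.or_eq_true] at h
  rcases h with (((h | h) | h) | h) | h
  · convert ordConnected_empty
    exact eq_empty_of_forall_notMem fun t ht => (lt_bern_of_pos h ht.1).not_ge ht.2
  · convert ordConnected_Icc using 1
    exact sep_eq_self_iff_mem_true.2 fun t ht => (bern_lt_of_neg h ht).le
  · exact ⟨fun x hx y hy z hz => ⟨Icc_subset_Icc hx.1.1 hy.1.2 hz,
      ((strictMonoOn_of_incr h).monotoneOn (Icc_subset_Icc hx.1.1 hy.1.2 hz) hy.1 hz.2).trans hy.2⟩⟩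
  · exact ⟨fun x hx y hy z hz => ⟨Icc_subset_Icc hx.1.1 hy.1.2 hz,
      ((strictAntiOn_of_decr h).antitoneOn hx.1 (Icc_subset_Icc hx.1.1 hy.1.2 hz) hz.1).trans hx.2⟩⟩
  · exact ((convexOn_of_conv h).convex_le M).ordConnected

theorem ordConnected_of_suplevel (h : v.suplevel M = true) :
    OrdConnected {t ∈ Icc (0 : ℝ) 1 | M ≤ (v.map (Nat.cast : ℕ → ℝ)).bern t} := by
  simp only [suplevel, Bool.or_eq_true] at h
  rcases h with (((h | h) | h) | h) | h
  · convert ordConnected_Icc using 1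
    exact sep_eq_self_iff_mem_true.2 fun t ht => (lt_bern_of_pos h ht).le
  · convert ordConnected_empty
    exact eq_empty_of_forall_notMem fun t ht => (bern_lt_of_neg h ht.1).not_ge ht.2
  · exact ⟨fun x hx y hy z hz => ⟨Icc_subset_Icc hx.1.1 hy.1.2 hz,
      hx.2.trans ((strictMonoOn_of_incr h).monotoneOn hx.1 (Icc_subset_Icc hx.1.1 hy.1.2 hz) hz.1)⟩⟩
  · exact ⟨fun x hx y hy z hz => ⟨Icc_subset_Icc hx.1.1 hy.1.2 hz,
      hy.2.trans ((strictAntiOn_of_decr h).antitoneOn (Icc_subset_Icc hx.1.1 hy.1.2 hz) hy.1 hz.2)⟩⟩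
  · exact ((concaveOn_of_conc h).convex_ge M).ordConnected

end

end V

section

open Set

variable {q : V (V ℕ)} {M : ℕ}

theorem bern₂_eq_bern_columns (q : V (V ℕ)) (s t : ℝ) :
    bern₂ q s t = V.bern ⟨((q.map V.x0).map Nat.cast).bern s, ((q.map V.x1).map Nat.cast).bern s,
      ((q.map V.x2).map Nat.cast).bern s, ((q.map V.x3).map Nat.cast).bern s,
      ((q.map V.x4).map Nat.cast).bern s, ((q.map V.x5).map Nat.cast).bern s,
      ((q.map V.x6).map Nat.cast).bern s, ((q.map V.x7).map Nat.cast).bern s,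
      ((q.map V.x8).map Nat.cast).bern s⟩ t := by
  simp only [bern₂, V.bern, V.map]
  ring

theorem V.continuous_bern_comp {a0 a1 a2 a3 a4 a5 a6 a7 a8 s : ℝ × ℝ → ℝ} (h0 : Continuous a0)
    (h1 : Continuous a1) (h2 : Continuous a2) (h3 : Continuous a3) (h4 : Continuous a4)
    (h5 : Continuous a5) (h6 : Continuous a6) (h7 : Continuous a7) (h8 : Continuous a8)
    (hs : Continuous s) :
    Continuous fun p =>
      V.bern ⟨a0 p, a1 p, a2 p, a3 p, a4 p, a5 p, a6 p, a7 p, a8 p⟩ (s p) := by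
  simp only [V.bern]
  fun_prop

theorem continuous_bern₂ (q : V (V ℕ)) : Continuous (Function.uncurry (bern₂ q)) := by
  have h (r : V ℕ) : Continuous fun p : ℝ × ℝ => (r.map (Nat.cast : ℕ → ℝ)).bern p.2 :=
    (V.continuous_bern _).comp continuous_snd
  exact V.continuous_bern_comp (h _) (h _) (h _) (h _) (h _) (h _) (h _) (h _) (h _)
    continuous_fst

theorem lt_bern₂_of_pos (h : q.all (V.pos M) = true) {s t : ℝ} (hs : s ∈ Icc (0 : ℝ) 1)
    (ht : t ∈ Icc (0 : ℝ) 1) : M < bern₂ q s t := by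
  simp only [V.all, Bool.and_eq_true] at h
  have e : (M : ℝ) = V.bern ⟨M, M, M, M, M, M, M, M, M⟩ s := by simp only [V.bern]; ring
  rw [e]
  apply V.bern_lt_bern hs <;> simp only [V.map] <;> refine V.lt_bern_of_pos ?_ ht <;> simp only [h]

theorem bern₂_lt_of_neg (h : q.all (V.neg M) = true) {s t : ℝ} (hs : s ∈ Icc (0 : ℝ) 1)
    (ht : t ∈ Icc (0 : ℝ) 1) : bern₂ q s t < M := by
  simp only [V.all, Bool.and_eq_true] at h
  have e : (M : ℝ) = V.bern ⟨M, M, M, M, M, M, M, M, M⟩ s := by simp only [V.bern]; ring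
  rw [e]
  apply V.bern_lt_bern hs <;> simp only [V.map] <;> refine V.bern_lt_of_neg ?_ ht <;> simp only [h]

theorem bern₂_ne_of_nonvanishing (h : nonvanishing M q = true) {s t : ℝ}
    (hs : s ∈ Icc (0 : ℝ) 1) (ht : t ∈ Icc (0 : ℝ) 1) : bern₂ q s t ≠ M := by
  rcases Bool.or_eq_true _ _ ▸ h with h | h
  · exact (lt_bern₂_of_pos h hs ht).ne'
  · exact (bern₂_lt_of_neg h hs ht).ne

theorem bern₂_zero_right (q : V (V ℕ)) (s : ℝ) :
    bern₂ q s 0 = ((q.map V.x0).map (Nat.cast : ℕ → ℝ)).bern s := by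
  rw [bern₂_eq_bern_columns, V.bern_zero]

theorem bern₂_one_right (q : V (V ℕ)) (s : ℝ) :
    bern₂ q s 1 = ((q.map V.x8).map (Nat.cast : ℕ → ℝ)).bern s := by
  rw [bern₂_eq_bern_columns, V.bern_one]

theorem bern₂_zero_left (q : V (V ℕ)) (t : ℝ) :
    bern₂ q 0 t = (q.x0.map (Nat.cast : ℕ → ℝ)).bern t := by
  rw [bern₂, V.bern_zero]
  rfl

theorem bern₂_one_left (q : V (V ℕ)) (t : ℝ) :
    bern₂ q 1 t = (q.x8.map (Nat.cast : ℕ → ℝ)).bern t := by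
  rw [bern₂, V.bern_one]
  rfl

theorem bern₂_strictMonoOn_right (h : q.all V.incr = true) {s : ℝ} (hs : s ∈ Icc (0 : ℝ) 1) :
    StrictMonoOn (bern₂ q s) (Icc 0 1) := by
  simp only [V.all, V.incr, V.chain, Bool.and_eq_true, Nat.blt_eq] at h
  rw [funext (bern₂_eq_bern_columns q s)]
  apply V.bern_strictMonoOn <;> apply V.bern_lt_bern hs <;>
    simp only [V.map, Nat.cast_lt, h]

theorem bern₂_strictAntiOn_right (h : q.all V.decr = true) {s : ℝ} (hs : s ∈ Icc (0 : ℝ) 1) :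
    StrictAntiOn (bern₂ q s) (Icc 0 1) := by
  simp only [V.all, V.decr, V.chain, Bool.and_eq_true, Nat.blt_eq] at h
  rw [funext (bern₂_eq_bern_columns q s)]
  intro x hx y hy hxy
  rw [← neg_lt_neg_iff, ← V.bern_map_neg, ← V.bern_map_neg]
  refine V.bern_strictMonoOn ?_ ?_ ?_ ?_ ?_ ?_ ?_ ?_ hx hy hxy <;>
    rw [V.map, neg_lt_neg_iff] <;> apply V.bern_lt_bern hs <;>
    simp only [V.map, Nat.cast_lt, h]

theorem bern₂_strictMonoOn_left (h : q.chain V.ltAll = true) {t : ℝ} (ht : t ∈ Icc (0 : ℝ) 1) :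
    StrictMonoOn (fun s => bern₂ q s t) (Icc 0 1) := by
  simp only [V.chain, Bool.and_eq_true] at h
  apply V.bern_strictMonoOn <;> simp only [V.map] <;>
    refine V.bern_lt_of_ltAll ?_ ht <;> simp only [h]

theorem bern₂_strictAntiOn_left (h : q.chain (fun v w => w.ltAll v) = true) {t : ℝ}
    (ht : t ∈ Icc (0 : ℝ) 1) : StrictAntiOn (fun s => bern₂ q s t) (Icc 0 1) := by
  simp only [V.chain, Bool.and_eq_true] at h
  intro x hx y hy hxy
  simp only [bern₂]
  rw [← neg_lt_neg_iff, ← V.bern_map_neg, ← V.bern_map_neg]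
  refine V.bern_strictMonoOn ?_ ?_ ?_ ?_ ?_ ?_ ?_ ?_ hx hy hxy <;>
    simp only [V.map, neg_lt_neg_iff] <;> refine V.bern_lt_of_ltAll ?_ ht <;> simp only [h]

attribute [local irreducible] bern₂

theorem isPreconnected_zeros_of_graphT (h : graphT M q = true) {I : Set ℝ} (hI : OrdConnected I)
    (hI' : I ⊆ Icc 0 1) :
    IsPreconnected {p : ℝ × ℝ | p.1 ∈ I ∧ p.2 ∈ Icc (0 : ℝ) 1 ∧ bern₂ q p.1 p.2 = M} := by
  simp only [graphT, Bool.or_eq_true, Bool.and_eq_true] at h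
  rcases h with ⟨⟨h, h0⟩, h1⟩ | ⟨⟨h, h0⟩, h1⟩
  · have := isPreconnected_zeros_of_strictMonoOn (g := fun s t => bern₂ q s t - M)
      ((continuous_bern₂ q).sub continuous_const)
      (fun s hs x hx y hy hxy =>
        sub_lt_sub_right (bern₂_strictMonoOn_right h hs hx hy hxy) _)
      (by simpa only [bern₂_zero_right, sub_nonpos] using V.ordConnected_of_sublevel h0)
      (by simpa only [bern₂_one_right, sub_nonneg] using V.ordConnected_of_suplevel h1) hI hI'
    simpa only [sub_eq_zero] using this
  · have := isPreconnected_zeros_of_strictMonoOn (g := fun s t => M - bern₂ q s t)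
      (continuous_const.sub (continuous_bern₂ q))
      (fun s hs x hx y hy hxy =>
        sub_lt_sub_left (bern₂_strictAntiOn_right h hs hx hy hxy) _)
      (by simpa only [bern₂_zero_right, sub_nonpos] using V.ordConnected_of_suplevel h0)
      (by simpa only [bern₂_one_right, sub_nonneg] using V.ordConnected_of_sublevel h1) hI hI'
    simpa only [sub_eq_zero, eq_comm] using this

theorem isPreconnected_zeros_of_graphS (h : graphS M q = true) :
    IsPreconnected
      {p : ℝ × ℝ | p.1 ∈ Icc (0 : ℝ) 1 ∧ p.2 ∈ Icc (0 : ℝ) 1 ∧ bern₂ q p.1 p.2 = M} := by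
  have hc : Continuous (Function.uncurry fun t s => bern₂ q s t) := by
    have h := continuous_bern₂ q
    simp only [Function.uncurry_def] at h ⊢
    exact h.comp (continuous_snd.prodMk continuous_fst)
  have key : IsPreconnected
      {p : ℝ × ℝ | p.1 ∈ Icc (0 : ℝ) 1 ∧ p.2 ∈ Icc (0 : ℝ) 1 ∧ bern₂ q p.2 p.1 = M} := by
    simp only [graphS, Bool.or_eq_true, Bool.and_eq_true] at h
    rcases h with ⟨⟨h, h0⟩, h1⟩ | ⟨⟨h, h0⟩, h1⟩
    · have := isPreconnected_zeros_of_strictMonoOn (g := fun t s => bern₂ q s t - M)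
        (hc.sub continuous_const)
        (fun s hs x hx y hy hxy =>
          sub_lt_sub_right (bern₂_strictMonoOn_left h hs hx hy hxy) _)
        (by simpa only [bern₂_zero_left, sub_nonpos] using V.ordConnected_of_sublevel h0)
        (by simpa only [bern₂_one_left, sub_nonneg] using V.ordConnected_of_suplevel h1)
        ordConnected_Icc subset_rfl
      simpa only [sub_eq_zero] using this
    · have := isPreconnected_zeros_of_strictMonoOn (g := fun t s => M - bern₂ q s t)
        (continuous_const.sub hc)
        (fun s hs x hx y hy hxy =>
          sub_lt_sub_left (bern₂_strictAntiOn_left h hs hx hy hxy) _)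
        (by simpa only [bern₂_zero_left, sub_nonpos] using V.ordConnected_of_suplevel h0)
        (by simpa only [bern₂_one_left, sub_nonneg] using V.ordConnected_of_sublevel h1)
        ordConnected_Icc subset_rfl
      simpa only [sub_eq_zero, eq_comm] using this
  convert key.image Prod.swap continuous_swap.continuousOn using 1
  ext ⟨s, t⟩
  simp [Prod.exists, and_left_comm, and_assoc]
  tauto

end

/-- The homogenization of the hessian determinant of `f`. -/
noncomputable def hom (X Y W : ℝ) : ℝ :=
  -13469 * W ^ 8 - 34740 * Y * W ^ 7 + 110222 * Y ^ 2 * W ^ 6 + 83368 * Y ^ 3 * W ^ 5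
    - 118527 * Y ^ 4 * W ^ 4 + 119420 * Y ^ 5 * W ^ 3 - 264594 * Y ^ 6 * W ^ 2
    + 171540 * Y ^ 7 * W - 47725 * Y ^ 8 - 1088 * X * W ^ 7 + 5056 * X * Y * W ^ 6
    + 300300 * X * Y ^ 2 * W ^ 5 - 85316 * X * Y ^ 3 * W ^ 4 - 804772 * X * Y ^ 4 * W ^ 3
    + 319656 * X * Y ^ 5 * W ^ 2 - 610200 * X * Y ^ 6 * W + 229140 * X * Y ^ 7
    + 123098 * X ^ 2 * W ^ 6 + 490536 * X ^ 2 * Y * W ^ 5 - 890112 * X ^ 2 * Y ^ 2 * W ^ 4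
    - 1380648 * X ^ 2 * Y ^ 3 * W ^ 3 - 54264 * X ^ 2 * Y ^ 4 * W ^ 2
    - 518280 * X ^ 2 * Y ^ 5 * W + 275790 * X ^ 2 * Y ^ 6 - 118124 * X ^ 3 * W ^ 5
    + 420984 * X ^ 3 * Y * W ^ 4 - 1706152 * X ^ 3 * Y ^ 2 * W ^ 3
    - 525536 * X ^ 3 * Y ^ 3 * W ^ 2 + 2192400 * X ^ 3 * Y ^ 4 * W - 896540 * X ^ 3 * Y ^ 5
    - 475511 * X ^ 4 * W ^ 4 - 20892 * X ^ 4 * Y * W ^ 3 + 451380 * X ^ 4 * Y ^ 2 * W ^ 2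
    + 2176120 * X ^ 4 * Y ^ 3 * W - 817555 * X ^ 4 * Y ^ 4 + 114040 * X ^ 5 * W ^ 3
    + 379416 * X ^ 5 * Y * W ^ 2 - 47760 * X ^ 5 * Y ^ 2 * W + 591780 * X ^ 5 * Y ^ 3
    + 369558 * X ^ 6 * W ^ 2 - 305520 * X ^ 6 * Y * W + 285290 * X ^ 6 * Y ^ 2
    + 126060 * X ^ 7 * W - 358180 * X ^ 7 * Y - 186925 * X ^ 8

/-- The homogenization of the hessian determinant of `f` in Horner form. -/
def homInt (X Y W : ℤ) : ℤ :=
  let W2 := W * W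
  let W3 := W2 * W
  let W4 := W3 * W
  let W5 := W4 * W
  let W6 := W5 * W
  let W7 := W6 * W
  let W8 := W7 * W
  let r8 := (-186925)
  let r7 := (-358180) * Y + 126060 * W
  let r6 := ((285290) * Y + (-305520) * W) * Y + 369558 * W2
  let r5 := (((591780) * Y + (-47760) * W) * Y + 379416 * W2) * Y + 114040 * W3
  let r4 := ((((-817555) * Y + 2176120 * W) * Y + 451380 * W2) * Y + (-20892) * W3) * Y +
    (-475511) * W4
  let r3 := (((((-896540) * Y + 2192400 * W) * Y + (-525536) * W2) * Y + (-1706152) * W3) * Y +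
    420984 * W4) * Y + (-118124) * W5
  let r2 := ((((((275790) * Y + (-518280) * W) * Y + (-54264) * W2) * Y + (-1380648) * W3) * Y +
    (-890112) * W4) * Y + 490536 * W5) * Y + 123098 * W6
  let r1 := (((((((229140) * Y + (-610200) * W) * Y + 319656 * W2) * Y + (-804772) * W3) * Y +
    (-85316) * W4) * Y + 300300 * W5) * Y + 5056 * W6) * Y + (-1088) * W7
  let r0 := ((((((((-47725) * Y + 171540 * W) * Y + (-264594) * W2) * Y + 119420 * W3) * Y +
    (-118527) * W4) * Y + 83368 * W5) * Y + 110222 * W6) * Y + (-34740) * W7) * Y + (-13469) * W8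
  (((((((r8 * X + r7) * X + r6) * X + r5) * X + r4) * X + r3) * X + r2) * X + r1) * X + r0

theorem cast_homInt (X Y W : ℤ) : (homInt X Y W : ℝ) = hom X Y W := by
  simp only [homInt, hom]
  push_cast
  ring

theorem continuous_hom : Continuous fun p : ℝ × ℝ => hom p.1 p.2 1 := by
  unfold hom
  fun_prop

theorem hom_mul_pow (x y W : ℝ) : hom x y 1 * W ^ 8 = hom (x * W) (y * W) W := by
  unfold hom
  ring

theorem mem_Z_iff {p : ℝ × ℝ} : p ∈ Z ↔ hom p.1 p.2 1 = 0 := by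
  have hofNat (i : Fin 2) (n : ℕ) [n.AtLeastTwo] :
      pderiv i (OfNat.ofNat n : MvPolynomial (Fin 2) ℝ) = 0 := by
    rw [← map_ofNat C n, pderiv_C]
  have h₁₀ : pderiv 1 (X 0 : MvPolynomial (Fin 2) ℝ) = 0 := pderiv_X_of_ne (by decide)
  have h₀₁ : pderiv 0 (X 1 : MvPolynomial (Fin 2) ℝ) = 0 := pderiv_X_of_ne (by decide)
  have h : eval ![p.1, p.2] (Hess f) = hom p.1 p.2 1 := by
    simp only [Hess, f, map_add, map_sub, map_neg, Derivation.leibniz,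
      Derivation.leibniz_pow, hofNat, h₁₀, h₀₁, pderiv_X_self, smul_eq_mul, nsmul_eq_mul,
      mul_zero, add_zero, zero_add, mul_one, neg_zero, sub_zero, zero_sub,
      Derivation.map_natCast]
    simp only [map_add, map_sub, map_neg, map_mul, map_pow, map_natCast, map_ofNat, eval_X,
      Matrix.cons_val_zero, Matrix.cons_val_one]
    unfold hom
    norm_num
    ring
  rw [Z, Set.mem_ofPred_eq, h]

theorem isClosed_Z : IsClosed Z := by
  have : Z = (fun p : ℝ × ℝ => hom p.1 p.2 1) ⁻¹' {0} := Set.ext fun p => mem_Z_iff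
  rw [this]
  exact isClosed_singleton.preimage continuous_hom

/-! The plane is covered by the square `[-8, 8]²` and four charts of the projective plane. -/

noncomputable def chartX : ℕ → ℝ → ℝ → ℝ
  | 0, s, _ => 8 * (2 * s - 1)
  | 1, _, _ => 8
  | 2, _, _ => -8
  | 3, _, t => 8 * (2 * t - 1)
  | _, _, t => -8 * (2 * t - 1)

noncomputable def chartY : ℕ → ℝ → ℝ → ℝ
  | 0, _, t => 8 * (2 * t - 1)
  | 1, _, t => 8 * (2 * t - 1)
  | 2, _, t => -8 * (2 * t - 1)
  | 3, _, _ => 8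
  | _, _, _ => -8

noncomputable def chartW : ℕ → ℝ → ℝ
  | 0, _ => 1
  | _, s => s

/-- The point of the plane with coordinates `s` and `t` in the given chart. -/
noncomputable def chart (ch : ℕ) (s t : ℝ) : ℝ × ℝ :=
  (chartX ch s t / chartW ch s, chartY ch s t / chartW ch s)

/-- The polynomial of the curve in the given chart. -/
noncomputable def chartPoly (ch : ℕ) (s t : ℝ) : ℝ :=
  hom (chartX ch s t) (chartY ch s t) (chartW ch s)

section

variable {R : Type} [CommRing R]

/-- The numerator of the first chart coordinate. -/
def formS : ℕ → R → R → R → R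
  | 0, X, _, W => X + 8 * W
  | _, _, _, W => 16 * W

/-- The numerator of the second chart coordinate. -/
def formT : ℕ → R → R → R → R
  | 0, _, Y, W => Y + 8 * W
  | 1, X, Y, _ => X + Y
  | 2, X, Y, _ => -X - Y
  | 3, X, Y, _ => X + Y
  | _, X, Y, _ => -X - Y

/-- The common denominator of the chart coordinates. -/
def formD : ℕ → R → R → R → R
  | 0, _, _, W => 16 * W
  | 1, X, _, _ => 2 * X
  | 2, X, _, _ => -(2 * X)
  | 3, _, Y, _ => 2 * Y
  | _, _, Y, _ => -(2 * Y)

/-- Being in the cone over a cell. -/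
def Cell.Mem [PartialOrder R] (k : Cell) (X Y W : R) : Prop :=
  0 ≤ formD k.ch X Y W ∧
    k.a * formD k.ch X Y W ≤ 2048 * formS k.ch X Y W ∧
    2048 * formS k.ch X Y W ≤ k.b * formD k.ch X Y W ∧
    k.c * formD k.ch X Y W ≤ 2048 * formT k.ch X Y W ∧
    2048 * formT k.ch X Y W ≤ k.d * formD k.ch X Y W

end

/-- The part of a cell in the affine plane. -/
def Cell.set (k : Cell) : Set (ℝ × ℝ) := {p | k.Mem p.1 p.2 1}

theorem cast_formS (ch : ℕ) (X Y W : ℤ) :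
    ((formS ch X Y W : ℤ) : ℝ) = formS ch (X : ℝ) Y W := by
  rcases ch with _ | _ <;> simp [formS]

theorem cast_formT (ch : ℕ) (X Y W : ℤ) :
    ((formT ch X Y W : ℤ) : ℝ) = formT ch (X : ℝ) Y W := by
  rcases ch with _ | _ | _ | _ | _ <;> simp [formT]

theorem cast_formD (ch : ℕ) (X Y W : ℤ) :
    ((formD ch X Y W : ℤ) : ℝ) = formD ch (X : ℝ) Y W := by
  rcases ch with _ | _ | _ | _ | _ <;> simp [formD]

theorem Cell.Mem.cast {k : Cell} {X Y W : ℤ} (h : k.Mem X Y W) : k.Mem (X : ℝ) Y W := by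
  obtain ⟨h0, h1, h2, h3, h4⟩ := h
  simp only [Cell.Mem, ← cast_formS, ← cast_formT, ← cast_formD]
  refine ⟨?_, ?_, ?_, ?_, ?_⟩ <;> assumption_mod_cast

theorem formS_add (ch : ℕ) (u v x y w x' y' w' : ℝ) :
    formS ch (u * x + v * x') (u * y + v * y') (u * w + v * w') =
      u * formS ch x y w + v * formS ch x' y' w' := by
  rcases ch with _ | _ <;> simp only [formS] <;> ring

theorem formT_add (ch : ℕ) (u v x y w x' y' w' : ℝ) :
    formT ch (u * x + v * x') (u * y + v * y') (u * w + v * w') =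
      u * formT ch x y w + v * formT ch x' y' w' := by
  rcases ch with _ | _ | _ | _ | _ <;> simp only [formT] <;> ring

theorem formD_add (ch : ℕ) (u v x y w x' y' w' : ℝ) :
    formD ch (u * x + v * x') (u * y + v * y') (u * w + v * w') =
      u * formD ch x y w + v * formD ch x' y' w' := by
  rcases ch with _ | _ | _ | _ | _ <;> simp only [formD] <;> ring

theorem Cell.Mem.add {k : Cell} {x y w x' y' w' u v : ℝ} (h : k.Mem x y w) (h' : k.Mem x' y' w')
    (hu : 0 ≤ u) (hv : 0 ≤ v) :
    k.Mem (u * x + v * x') (u * y + v * y') (u * w + v * w') := by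
  obtain ⟨h0, h1, h2, h3, h4⟩ := h
  obtain ⟨h0', h1', h2', h3', h4'⟩ := h'
  simp only [Cell.Mem, formS_add, formT_add, formD_add]
  have key {p q p' q' : ℝ} (h : p ≤ q) (h' : p' ≤ q') : u * p + v * p' ≤ u * q + v * q' :=
    add_le_add (mul_le_mul_of_nonneg_left h hu) (mul_le_mul_of_nonneg_left h' hv)
  exact ⟨by positivity, by linarith [key h1 h1'], by linarith [key h2 h2'],
    by linarith [key h3 h3'], by linarith [key h4 h4']⟩

theorem Cell.convex_set (k : Cell) : Convex ℝ k.set := by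
  intro p hp q hq u v hu hv huv
  have h : k.Mem _ _ _ := Cell.Mem.add (w := 1) (w' := 1) hp hq hu hv
  rwa [mul_one, mul_one, huv] at h

theorem Cell.isClosed_set (k : Cell) : IsClosed k.set := by
  have hS : Continuous fun p : ℝ × ℝ => formS k.ch p.1 p.2 1 := by
    rcases k.ch with _ | _ <;> simp only [formS] <;> fun_prop
  have hT : Continuous fun p : ℝ × ℝ => formT k.ch p.1 p.2 1 := by
    rcases k.ch with _ | _ | _ | _ | _ <;> simp only [formT] <;> fun_prop
  have hD : Continuous fun p : ℝ × ℝ => formD k.ch p.1 p.2 1 := by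
    rcases k.ch with _ | _ | _ | _ | _ <;> simp only [formD] <;> fun_prop
  exact (isClosed_le continuous_const hD).inter <|
    (isClosed_le (hD.const_mul _) (hS.const_mul _)).inter <|
    (isClosed_le (hS.const_mul _) (hD.const_mul _)).inter <|
    (isClosed_le (hD.const_mul _) (hT.const_mul _)).inter <|
    isClosed_le (hT.const_mul _) (hD.const_mul _)

theorem chart_form_div {ch : ℕ} {p : ℝ × ℝ} (hD : 0 < formD ch p.1 p.2 1) :
    0 < chartW ch (formS ch p.1 p.2 1 / formD ch p.1 p.2 1) ∧
      chart ch (formS ch p.1 p.2 1 / formD ch p.1 p.2 1)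
        (formT ch p.1 p.2 1 / formD ch p.1 p.2 1) = p := by
  obtain ⟨x, y⟩ := p
  rcases ch with _ | _ | _ | _ | _ <;>
    simp only [formD, formS, formT, chartW, chart, chartX, chartY, zero_add, Prod.mk.injEq] at hD ⊢
  · refine ⟨one_pos, ?_, ?_⟩ <;> ring
  all_goals
    refine ⟨by positivity, ?_⟩
  · have : x ≠ 0 := by rintro rfl; simp at hD
    constructor <;> field_simp <;> ring
  · have : x ≠ 0 := by rintro rfl; simp at hD
    constructor <;> field_simp <;> ring
  · have : y ≠ 0 := by rintro rfl; simp at hD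
    constructor <;> field_simp <;> ring
  · have : y ≠ 0 := by rintro rfl; simp at hD
    constructor <;> field_simp <;> ring

theorem form_chart {ch : ℕ} {s : ℝ} (t : ℝ) (hW : 0 < chartW ch s) :
    0 < formD ch (chart ch s t).1 (chart ch s t).2 1 ∧
      formS ch (chart ch s t).1 (chart ch s t).2 1 =
        s * formD ch (chart ch s t).1 (chart ch s t).2 1 ∧
      formT ch (chart ch s t).1 (chart ch s t).2 1 =
        t * formD ch (chart ch s t).1 (chart ch s t).2 1 := by
  rcases ch with _ | _ | _ | _ | _ <;>
    simp only [formD, formS, formT, chartW, chart, chartX, chartY, zero_add] at hW ⊢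
  · refine ⟨by norm_num, by ring, by ring⟩
  all_goals
    have h8 : 0 < 8 / s := by positivity
    refine ⟨by linarith [neg_div s 8], ?_, ?_⟩ <;> field_simp <;> ring

theorem Cell.mem_set_iff {k : Cell} {p : ℝ × ℝ} :
    p ∈ k.set ↔ ∃ s t : ℝ, k.a ≤ 2048 * s ∧ 2048 * s ≤ k.b ∧ k.c ≤ 2048 * t ∧ 2048 * t ≤ k.d ∧
      0 < chartW k.ch s ∧ chart k.ch s t = p := by
  constructor
  · rintro ⟨h0, h1, h2, h3, h4⟩
    have hD : 0 < formD k.ch p.1 p.2 1 := by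
      refine h0.lt_of_ne fun h => ?_
      rw [← h, mul_zero] at h2 h1
      have : 0 < formS k.ch p.1 p.2 1 ∨ 0 < formD k.ch p.1 p.2 1 := by
        rcases k.ch with _ | _ <;> simp [formS, formD]
      rcases this with h | h <;> linarith
    refine ⟨_, _, ?_, ?_, ?_, ?_, chart_form_div hD⟩
    · rwa [← mul_div_assoc, le_div_iff₀ hD]
    · rwa [← mul_div_assoc, div_le_iff₀ hD]
    · rwa [← mul_div_assoc, le_div_iff₀ hD]
    · rwa [← mul_div_assoc, div_le_iff₀ hD]
  · rintro ⟨s, t, h1, h2, h3, h4, hW, rfl⟩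
    obtain ⟨hD, hS, hT⟩ := form_chart t hW
    refine ⟨hD.le, ?_, ?_, ?_, ?_⟩
    · rw [hS, ← mul_assoc]
      gcongr
    · rw [hS, ← mul_assoc]
      gcongr
    · rw [hT, ← mul_assoc]
      gcongr
    · rw [hT, ← mul_assoc]
      gcongr

theorem chart_mem_Z_iff {ch : ℕ} {s t : ℝ} (hW : 0 < chartW ch s) :
    chart ch s t ∈ Z ↔ chartPoly ch s t = 0 := by
  rw [mem_Z_iff, chartPoly]
  have h := hom_mul_pow (chart ch s t).1 (chart ch s t).2 (chartW ch s)
  simp only [chart] at h ⊢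
  rw [div_mul_cancel₀ _ hW.ne', div_mul_cancel₀ _ hW.ne'] at h
  rw [← h, mul_eq_zero, or_iff_left (pow_ne_zero _ hW.ne')]

section

open Set

attribute [local irreducible] bern₂

/-- Up to an affine change of the values, the polynomial of the curve in the cell `k` has
the Bernstein coefficients `q`. -/
def Represents (q : V (V ℕ)) (M : ℕ) (k : Cell) : Prop :=
  ∃ C : ℝ, C ≠ 0 ∧ ∀ σ τ : ℝ, bern₂ q σ τ =
    C * chartPoly k.ch ((k.a + (k.b - k.a) * σ) / 2048) ((k.c + (k.d - k.c) * τ) / 2048) + M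

variable {q : V (V ℕ)} {M m : ℕ} {k : Cell}

theorem Represents.eq_iff (h : Represents q M k) (σ τ : ℝ) : bern₂ q σ τ = M ↔
    chartPoly k.ch ((k.a + (k.b - k.a) * σ) / 2048) ((k.c + (k.d - k.c) * τ) / 2048) = 0 := by
  obtain ⟨C, hC, h⟩ := h
  rw [h, add_eq_right, mul_eq_zero, or_iff_right hC]

theorem Represents.splitS_fst (h : Represents q M k) (hm : m + m = k.a + k.b) :
    Represents (splitS q).1 (256 * M) ⟨k.ch, k.a, m, k.c, k.d⟩ := by
  obtain ⟨C, hC, h⟩ := h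
  have hm' : (m + m : ℝ) = k.a + k.b := mod_cast hm
  refine ⟨256 * C, by positivity, fun σ τ => ?_⟩
  rw [bern₂_splitS_fst, h, show (k.b - k.a : ℝ) * (σ / 2) = (m - k.a) * σ by
    linear_combination -σ / 2 * hm']
  push_cast
  ring

theorem Represents.splitS_snd (h : Represents q M k) (hm : m + m = k.a + k.b) :
    Represents (splitS q).2 (256 * M) ⟨k.ch, m, k.b, k.c, k.d⟩ := by
  obtain ⟨C, hC, h⟩ := h
  have hm' : (m + m : ℝ) = k.a + k.b := mod_cast hm
  refine ⟨256 * C, by positivity, fun σ τ => ?_⟩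
  rw [bern₂_splitS_snd, h, show (k.a + (k.b - k.a) * ((1 + σ) / 2) : ℝ) = m + (k.b - m) * σ by
    linear_combination (σ - 1) / 2 * hm']
  push_cast
  ring

theorem Represents.splitT_fst (h : Represents q M k) (hm : m + m = k.c + k.d) :
    Represents (splitT q).1 (256 * M) ⟨k.ch, k.a, k.b, k.c, m⟩ := by
  obtain ⟨C, hC, h⟩ := h
  have hm' : (m + m : ℝ) = k.c + k.d := mod_cast hm
  refine ⟨256 * C, by positivity, fun σ τ => ?_⟩
  rw [bern₂_splitT_fst, h, show (k.d - k.c : ℝ) * (τ / 2) = (m - k.c) * τ by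
    linear_combination -τ / 2 * hm']
  push_cast
  ring

theorem Represents.splitT_snd (h : Represents q M k) (hm : m + m = k.c + k.d) :
    Represents (splitT q).2 (256 * M) ⟨k.ch, k.a, k.b, m, k.d⟩ := by
  obtain ⟨C, hC, h⟩ := h
  have hm' : (m + m : ℝ) = k.c + k.d := mod_cast hm
  refine ⟨256 * C, by positivity, fun σ τ => ?_⟩
  rw [bern₂_splitT_snd, h, show (k.c + (k.d - k.c) * ((1 + τ) / 2) : ℝ) = m + (k.d - m) * τ by
    linear_combination (τ - 1) / 2 * hm']
  push_cast
  ring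

theorem chartW_mono (ch : ℕ) : Monotone (chartW ch) := by
  rcases ch with _ | _
  · exact fun _ _ _ => le_rfl
  · exact fun _ _ h => h

theorem continuous_chartX (ch : ℕ) : Continuous fun p : ℝ × ℝ => chartX ch p.1 p.2 := by
  rcases ch with _ | _ | _ | _ | _ <;> simp only [chartX] <;> fun_prop

theorem continuous_chartY (ch : ℕ) : Continuous fun p : ℝ × ℝ => chartY ch p.1 p.2 := by
  rcases ch with _ | _ | _ | _ | _ <;> simp only [chartY] <;> fun_prop

theorem continuous_chartW (ch : ℕ) : Continuous (chartW ch) := by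
  rcases ch with _ | _
  · exact continuous_const
  · exact continuous_id

/-- The zeros in a cell in terms of local coordinates. -/
theorem Represents.inter_eq_image (h : Represents q M k) (hab : k.a < k.b) (hcd : k.c < k.d) :
    Z ∩ k.set = (fun p : ℝ × ℝ =>
        chart k.ch ((k.a + (k.b - k.a) * p.1) / 2048) ((k.c + (k.d - k.c) * p.2) / 2048)) ''
      {p | p.1 ∈ {σ ∈ Icc (0 : ℝ) 1 | 0 < chartW k.ch ((k.a + (k.b - k.a) * σ) / 2048)} ∧
        p.2 ∈ Icc (0 : ℝ) 1 ∧ bern₂ q p.1 p.2 = M} := by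
  have hab' : (0 : ℝ) < k.b - k.a := sub_pos.2 (mod_cast hab)
  have hcd' : (0 : ℝ) < k.d - k.c := sub_pos.2 (mod_cast hcd)
  ext p
  simp only [mem_inter_iff, mem_image, Prod.exists, mem_ofPred_eq, Cell.mem_set_iff, mem_Icc]
  constructor
  · rintro ⟨hp, s, t, h1, h2, h3, h4, hW, rfl⟩
    refine ⟨(2048 * s - k.a) / (k.b - k.a), (2048 * t - k.c) / (k.d - k.c), ?_⟩
    have es : (k.a + (k.b - k.a) * ((2048 * s - k.a) / (k.b - k.a)) : ℝ) / 2048 = s := by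
      field_simp
      ring
    have et : (k.c + (k.d - k.c) * ((2048 * t - k.c) / (k.d - k.c)) : ℝ) / 2048 = t := by
      field_simp
      ring
    rw [h.eq_iff, es, et, div_le_one hab', div_le_one hcd']
    exact ⟨⟨⟨⟨div_nonneg (by linarith) hab'.le, by linarith⟩, hW⟩,
      ⟨div_nonneg (by linarith) hcd'.le, by linarith⟩, (chart_mem_Z_iff hW).1 hp⟩, rfl⟩
  · rintro ⟨σ, τ, ⟨⟨⟨hσ0, hσ1⟩, hW⟩, ⟨hτ0, hτ1⟩, hz⟩, rfl⟩
    rw [h.eq_iff] at hz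
    have := mul_nonneg hab'.le hσ0
    have := mul_nonneg hcd'.le hτ0
    have := mul_le_mul_of_nonneg_left hσ1 hab'.le
    have := mul_le_mul_of_nonneg_left hτ1 hcd'.le
    exact ⟨(chart_mem_Z_iff hW).2 hz, _, _, by linarith, by linarith, by linarith, by linarith,
      hW, rfl⟩

theorem Represents.isPreconnected_of_graph (h : Represents q M k) (hab : k.a < k.b)
    (hcd : k.c < k.d) (hg : graph M q k.ch k.a = true) : IsPreconnected (Z ∩ k.set) := by
  have hab' : (0 : ℝ) < k.b - k.a := sub_pos.2 (mod_cast hab)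
  rw [h.inter_eq_image hab hcd]
  refine IsPreconnected.image ?_ _ fun p hp => ContinuousAt.continuousWithinAt ?_
  · rw [graph, Bool.or_eq_true, Bool.and_eq_true] at hg
    rcases hg with hg | ⟨h0, hg⟩
    · refine isPreconnected_zeros_of_graphT hg ⟨fun x hx y hy z hz => ?_⟩ (sep_subset _ _)
      refine ⟨Icc_subset_Icc hx.1.1 hy.1.2 hz, hx.2.trans_le (chartW_mono _ ?_)⟩
      have := mul_le_mul_of_nonneg_left hz.1 hab'.le
      linarith
    · have : {σ ∈ Icc (0 : ℝ) 1 | 0 < chartW k.ch ((k.a + (k.b - k.a) * σ) / 2048)} =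
          Icc 0 1 := by
        refine sep_eq_self_iff_mem_true.2 fun σ hσ => ?_
        rw [Bool.or_eq_true, Nat.beq_eq, Nat.blt_eq] at h0
        rcases h0 with h0 | h0
        · rw [h0]
          exact one_pos
        · have : (0 : ℝ) < k.a := mod_cast h0
          have := mul_nonneg hab'.le hσ.1
          have : (0 : ℝ) < (k.a + (k.b - k.a) * σ) / 2048 := by positivity
          rcases k.ch with _ | _
          · exact one_pos
          · exact this
      rw [this]
      exact isPreconnected_zeros_of_graphS hg
  · have hφ : Continuous fun p : ℝ × ℝ => (((k.a + (k.b - k.a) * p.1) / 2048 : ℝ),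
        ((k.c + (k.d - k.c) * p.2) / 2048 : ℝ)) := by fun_prop
    have hW := ((continuous_chartW k.ch).comp (continuous_fst.comp hφ)).continuousAt (x := p)
    exact (((continuous_chartX k.ch).comp hφ).continuousAt.div hW hp.1.2.ne').prodMk
      (((continuous_chartY k.ch).comp hφ).continuousAt.div hW hp.1.2.ne')

theorem Cell.eq_of_beq {k l : Cell} (h : k.beq l = true) : k = l := by
  cases k
  cases l
  simpa [Cell.beq, and_assoc] using h

theorem cover_sound (n : ℕ) {q : V (V ℕ)} {M : ℕ} {k : Cell} {L : List Cell}
    (h : cover n q M k L = true) (hq : Represents q M k) (hab : k.a < k.b) (hcd : k.c < k.d) :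
    (∀ l ∈ L, IsPreconnected (Z ∩ l.set)) ∧ ∀ p ∈ Z ∩ k.set, ∃ l ∈ L, p ∈ l.set := by
  induction n generalizing q M k L with
  | zero => simp [cover] at h
  | succ n ih =>
    have hsplit {P : Cell → Bool} {k₁ k₂ : Cell}
        (h₁ : (∀ l ∈ L.filter P, IsPreconnected (Z ∩ l.set)) ∧
          ∀ p ∈ Z ∩ k₁.set, ∃ l ∈ L.filter P, p ∈ l.set)
        (h₂ : (∀ l ∈ L.filter fun l => !P l, IsPreconnected (Z ∩ l.set)) ∧
          ∀ p ∈ Z ∩ k₂.set, ∃ l ∈ L.filter fun l => !P l, p ∈ l.set)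
        (hk : k.set ⊆ k₁.set ∪ k₂.set) :
        (∀ l ∈ L, IsPreconnected (Z ∩ l.set)) ∧ ∀ p ∈ Z ∩ k.set, ∃ l ∈ L, p ∈ l.set := by
      simp only [List.mem_filter] at h₁ h₂
      refine ⟨fun l hl => ?_, fun p hp => ?_⟩
      · by_cases hP : P l = true
        · exact h₁.1 l ⟨hl, hP⟩
        · exact h₂.1 l ⟨hl, by simp [hP]⟩
      · rcases hk hp.2 with hk | hk
        · obtain ⟨l, hl, hp⟩ := h₁.2 p ⟨hp.1, hk⟩
          exact ⟨l, hl.1, hp⟩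
        · obtain ⟨l, hl, hp⟩ := h₂.2 p ⟨hp.1, hk⟩
          exact ⟨l, hl.1, hp⟩
    rw [cover, Bool.or_eq_true, Bool.or_eq_true] at h
    rcases h with (h | h) | h
    · rw [Bool.and_eq_true, List.isEmpty_iff] at h
      refine ⟨by simp [h.1], fun p hp => ?_⟩
      rw [hq.inter_eq_image hab hcd] at hp
      obtain ⟨x, hx, -⟩ := hp
      exact absurd hx.2.2 (bern₂_ne_of_nonvanishing h.2 hx.1.1 hx.2.1)
    · simp only [Bool.and_eq_true, Bool.not_eq_true', List.all_eq_true] at h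
      obtain ⟨⟨hL, hall⟩, hg⟩ := h
      refine ⟨fun l hl => ?_, fun p hp => ?_⟩
      · rw [← Cell.eq_of_beq (hall l hl)]
        exact hq.isPreconnected_of_graph hab hcd hg
      · obtain ⟨l, hl⟩ := List.exists_mem_of_ne_nil L (by rintro rfl; simp at hL)
        exact ⟨l, hl, Cell.eq_of_beq (hall l hl) ▸ hp.2⟩
    · rw [Bool.cond_eq_ite] at h
      split_ifs at h
      · simp only [Bool.and_eq_true, Nat.beq_eq] at h
        obtain ⟨⟨hm, h₁⟩, h₂⟩ := h
        refine hsplit (ih h₁ (hq.splitS_fst hm) (by dsimp only; omega) hcd)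
          (ih h₂ (hq.splitS_snd hm) (by dsimp only; omega) hcd) fun p hp => ?_
        obtain ⟨h0, h1, h2, h3, h4⟩ := hp
        rcases le_total (2048 * formS k.ch p.1 p.2 1)
          (((k.a + k.b) / 2 : ℕ) * formD k.ch p.1 p.2 1) with h | h
        · exact .inl ⟨h0, h1, h, h3, h4⟩
        · exact .inr ⟨h0, h, h2, h3, h4⟩
      · simp only [Bool.and_eq_true, Nat.beq_eq] at h
        obtain ⟨⟨hm, h₁⟩, h₂⟩ := h
        refine hsplit (ih h₁ (hq.splitT_fst hm) hab (by dsimp only; omega))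
          (ih h₂ (hq.splitT_snd hm) hab (by dsimp only; omega)) fun p hp => ?_
        obtain ⟨h0, h1, h2, h3, h4⟩ := hp
        rcases le_total (2048 * formT k.ch p.1 p.2 1)
          (((k.c + k.d) / 2 : ℕ) * formD k.ch p.1 p.2 1) with h | h
        · exact .inl ⟨h0, h1, h2, h3, h⟩
        · exact .inr ⟨h0, h1, h2, h, h4⟩

end

def rootC : V (V ℕ) := ⟨
  ⟨0, 4220737358243000, 5313453347859440, 3726725251614120, 3593704469209568, 5803976119840920,
    5449027504972240, 5091470006003080, 5088717012102080⟩,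
  ⟨6145363796900160, 6022227756192760, 6961004947698480, 6548841678345960, 5923586946973472,
    6382968856161240, 5125222982294800, 5338761927283400, 5639033295965440⟩,
  ⟨5366043191488000, 3790748757859000, 4170662724496880, 4535109526304680, 4355143370147808,
    5015551323074200, 4546310528826320, 5598533424824200, 5430492852406720⟩,
  ⟨7316647632508480, 6547603395940600, 6166716419331120, 6412225566162920, 5957386733138976,
    6269983577247960, 5729453613233680, 6254108202402760, 4971482974312960⟩,
  ⟨3519853151234560, 4832382734945976, 4344783452937712, 4812365993035688, 4422798595488736,
    4766977476684440, 4435832937432016, 4762994325501832, 4013795042719168⟩,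
  ⟨4340212370186560, 6457771771276280, 5635537630184240, 6272333266052840, 5926957804951328,
    6323439453393880, 6220703842639120, 6434025262215880, 7076186621728000⟩,
  ⟨5285006332605440, 6050589906600120, 4496774926580720, 5086052294931880, 4449440588742112,
    4548316431623320, 4309298394577360, 3786996893109640, 4690000568397760⟩,
  ⟨5572271889128000, 5430121768625400, 4695794168594480, 6283315822971880, 5939813900036128,
    6385288816375000, 6904238110216720, 6211388490080200, 6194351195307520⟩,
  ⟨5211131735936000, 5179787511197880, 5349063777355760, 6312672213713320, 4017537264618976,
    3402047834774680, 4835116646276560, 4945749022097800, 3213380881332160⟩⟩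

def rootE : V (V ℕ) := ⟨
  ⟨17830992936960000, 17651881476096000, 19112914845696000, 22429302784000000,
    11099044419993600, 9839386296320000, 17355652464640000, 14839944577024000, 0⟩,
  ⟨17874871648256000, 17681256513536000, 19082174332928000, 22587886698496000,
    11230055733657600, 9735962722304000, 17205833695232000, 15072146259968000, 1022582063104000⟩,
  ⟨17922518364979200, 17718135368908800, 19053722763264000, 22747996040396800,
    11364946060247040, 9638317442662400, 17062992628940800, 15313532261171200, 2052912630988800⟩,
  ⟨17973134024294400, 17762268344934400, 19027492492083200, 22909688447180800,
    11503922408407040, 9546731017625600, 16927175795507200, 15563292795904000, 3088354593587200⟩,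
  ⟨18025789118812160, 17813318654853120, 19003358364221440, 23072983829811200,
    11647166088671232, 9461462679429120, 16798403263897600, 15820573196431360, 4126188517642240⟩,
  ⟨18079419309235200, 17870858427184000, 18981134191155200, 23237861536048000,
    11794830909992960, 9382750042544000, 16676670480102400, 16084478624636800, 5163621114803200⟩,
  ⟨18132821676144000, 17934365198850800, 18960569609870400, 23404257832850800,
    11947041676862080, 9310809140076400, 16561950500776000, 16354079294249200, 6197794377174400⟩,
  ⟨18184651652145300, 18003218927260175, 18941347343361450, 23572063717178725,
    12103892985674560, 9245834774364475, 16454196600107350, 16628416169422225, 7225795336427500⟩,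
  ⟨18233420659107675, 18076699535417075, 18923080866206475, 23741123047994275,
    12265448302522555, 9188001153301075, 16353345210810475, 16906507089916675, 8244666386088475⟩⟩

def rootW : V (V ℕ) := ⟨
  ⟨25653230957532325, 25474119496668325, 26935152866268325, 30251540804572325,
    18921282440565925, 17661624316892325, 25177890485212325, 22662182597596325, 7822238020572325⟩,
  ⟨25609352246236325, 25444744459228325, 26965893379036325, 30092956890076325,
    18790271126901925, 17765047890908325, 25327709254620325, 22429980914652325, 6799655957468325⟩,
  ⟨25569241540367525, 25422873239721125, 26998922834908325, 29935898402985125,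
    18663138826163365, 17874249759298725, 25484505727145125, 22206963549967525, 5784822399145125⟩,
  ⟨25533697902761125, 25408755535426725, 27034308878505125, 29780307705820325,
    18539678529705125, 17988949361833125, 25648233373045925, 21993940288271525, 4780374455669925⟩,
  ⟨25503389951698085, 25402553954145445, 27072061643904165, 29626089434588325,
    18419657530770597, 18108844810286245, 25818819201807525, 21791676031288485, 3788866913920165⟩,
  ⟨25478860248258725, 25404348009439525, 27112137277455525, 29473113335468325,
    18302819227960485, 18233613178207525, 25996161924341925, 21600886085113125, 2812763769487525⟩,
  ⟨25460530322815525, 25414138604242325, 27154441842282725, 29321217420591125,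
    18188885229287205, 18362911116859925, 26180130511031525, 21422231957189525, 1854430426034725⟩,
  ⟨25448706299441425, 25431852972250550, 27198835584522875, 29170211433602400,
    18077557758147685, 18496375809299850, 26370563168224975, 21256317696142900, 916126605994425⟩,
  ⟨25443585060510400, 25457350030015400, 27245137524861200, 29019880599204600,
    17968522346047840, 18633626258070600, 26567266739297200, 21103686791215000, 0⟩⟩

def rootN : V (V ℕ) := ⟨
  ⟨17830992936960000, 20366401470464000, 19112914845696000, 15588980162560000,
    11099044419993600, 28178896650240000, 17355652464640000, 23178338369536000, 0⟩,
  ⟨17787114225664000, 20384806830080000, 19157306900480000, 15785130360832000,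
    11251820396544000, 28102678904832000, 17146188595200000, 23201782202368000, 1022582063104000⟩,
  ⟨17747003519795200, 20397592374476800, 19196488679424000, 15976564655718400,
    11401488944332800, 28025802301440000, 16935419923660800, 23219915969331200, 2052912630988800⟩,
  ⟨17711459882188800, 20405107703500800, 19230613457920000, 16163443761049600,
    11548275758366720, 27948418705100800, 16723085897113600, 23231571622604800, 3088354593587200⟩,
  ⟨17681151931125760, 20407659061923840, 19259826982993920, 16345929214033920,
    11692404230844416, 27870671280189440, 16508908007956480, 23235543674183680, 4126188517642240⟩,
  ⟨17656622227686400, 20405510828393600, 19284267415705600, 16524182933961600,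
    11834095600020480, 27792696014300800, 16292593288652800, 23230595068374400, 5163621114803200⟩,
  ⟨17638292302243200, 20398887474725200, 19304065624331200, 16698367061371600,
    11973569358451840, 27714623529672400, 16073838171428800, 23215463545867600, 6197794377174400⟩,
  ⟨17626468278869100, 20387975953977100, 19319345786437900, 16868644035457900,
    12111043878070060, 27636581139258700, 15852332669687500, 23188868455830700, 7225795336427500⟩,
  ⟨17621347039938075, 20372928459254875, 19330226241461275, 17035176850992475,
    12246737193023515, 27558695088067675, 15627764821416475, 23149517955965275, 8244666386088475⟩⟩

def rootS : V (V ℕ) := ⟨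
  ⟨25653230957532325, 28188639491036325, 26935152866268325, 23411218183132325,
    18921282440565925, 36001134670812325, 25177890485212325, 31000576390108325, 7822238020572325⟩,
  ⟨25697109668828325, 28170234131420325, 26890760811484325, 23215067984860325,
    18768506464015525, 36077352416220325, 25387354354652325, 30977132557276325, 6799655957468325⟩,
  ⟨25744756385551525, 28146208956585125, 26841158480860325, 23014201883202725,
    18612623058703525, 36152911303644325, 25595513421993125, 30948378658575525, 5784822399145125⟩,
  ⟨25795372044866725, 28116214366684325, 26786192599004325, 22808459164329125,
    18453406529623205, 36227659468047525, 25802628240143525, 30915482741826725, 4780374455669925⟩,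
  ⟨25848027139384485, 28079857406796965, 26725702362158245, 22597679937787045,
    18290628878959781, 36301436343731365, 26008941407319205, 30879575414666405, 3788866913920165⟩,
  ⟨25901657329807525, 28036700277977125, 26659519495797925, 22381705577797925,
    18124059657226405, 36374071140453925, 26214674072284325, 30841743972050725, 2812763769487525⟩,
  ⟨25955059696716325, 27986259318644725, 26587468663015525, 22160379445015925,
    17953466073782565, 36445381607089525, 26420022804532325, 30803027015335925, 1854430426034725⟩,
  ⟨26006889672717625, 27928004497874425, 26509368265574425, 21933547930972825,
    17778613409291385, 36515173125719225, 26625156872628825, 30764409606491225, 916126605994425⟩,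
  ⟨26055658679680000, 27861359445640000, 26425031663027200, 21701061850932800,
    17599265756172800, 36583238162542400, 26830215957440000, 30726818984500800, 0⟩⟩

def loops : List (List Link) := [
  [⟨⟨0,939,940,826,828⟩, ⟨-85,-196,128⟩, ⟨-21,-49,32⟩⟩,
   ⟨⟨0,936,940,828,832⟩, ⟨-11,-24,16⟩, ⟨-21,-48,32⟩⟩,
   ⟨⟨0,936,940,832,840⟩, ⟨-11,-23,16⟩, ⟨-21,-46,32⟩⟩,
   ⟨⟨0,936,940,840,848⟩, ⟨-21,-45,32⟩, ⟨-21,-44,32⟩⟩,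
   ⟨⟨0,940,944,844,848⟩, ⟨-21,-44,32⟩, ⟨-5,-11,8⟩⟩, ⟨⟨0,928,944,848,864⟩, ⟨-3,-5,4⟩, ⟨-5,-10,8⟩⟩,
   ⟨⟨0,928,944,864,880⟩, ⟨-10,-19,16⟩, ⟨-5,-9,8⟩⟩,
   ⟨⟨0,944,948,872,880⟩, ⟨-5,-9,8⟩, ⟨-19,-36,32⟩⟩, ⟨⟨0,944,952,880,896⟩, ⟨-5,-8,8⟩, ⟨-9,-16,16⟩⟩,
   ⟨⟨0,944,952,896,912⟩, ⟨-5,-7,8⟩, ⟨-9,-14,16⟩⟩,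
   ⟨⟨0,944,952,912,920⟩, ⟨-9,-14,16⟩, ⟨-9,-13,16⟩⟩,
   ⟨⟨0,952,960,912,928⟩, ⟨-9,-12,16⟩, ⟨-2,-3,4⟩⟩, ⟨⟨0,952,960,928,944⟩, ⟨-2,-3,4⟩, ⟨-4,-5,8⟩⟩,
   ⟨⟨0,960,968,928,944⟩, ⟨-31,-48,64⟩, ⟨-15,-24,32⟩⟩,
   ⟨⟨0,962,964,924,928⟩, ⟨-15,-25,32⟩, ⟨-15,-24,32⟩⟩,
   ⟨⟨0,964,968,920,928⟩, ⟨-15,-26,32⟩, ⟨-7,-13,16⟩⟩,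
   ⟨⟨0,960,968,912,920⟩, ⟨-4,-7,8⟩, ⟨-7,-14,16⟩⟩, ⟨⟨0,960,976,896,912⟩, ⟨-1,-2,2⟩, ⟨-3,-8,8⟩⟩,
   ⟨⟨0,960,992,832,896⟩, ⟨-8,-19,16⟩, ⟨-4,-9,8⟩⟩,
   ⟨⟨0,956,960,872,880⟩, ⟨-17,-38,32⟩, ⟨-8,-19,16⟩⟩,
   ⟨⟨0,952,960,864,872⟩, ⟨-9,-20,16⟩, ⟨-2,-5,4⟩⟩,
   ⟨⟨0,952,960,848,864⟩, ⟨-9,-22,16⟩, ⟨-9,-21,16⟩⟩,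
   ⟨⟨0,948,952,848,856⟩, ⟨-19,-44,32⟩, ⟨-9,-22,16⟩⟩,
   ⟨⟨0,948,952,840,848⟩, ⟨-19,-46,32⟩, ⟨-19,-45,32⟩⟩,
   ⟨⟨0,944,948,840,844⟩, ⟨-10,-23,16⟩, ⟨-19,-46,32⟩⟩,
   ⟨⟨0,944,952,832,840⟩, ⟨-5,-12,8⟩, ⟨-20,-47,32⟩⟩,
   ⟨⟨0,942,944,832,836⟩, ⟨-41,-96,64⟩, ⟨-5,-12,8⟩⟩, ⟨⟨0,940,944,824,832⟩, ⟨0,0,1⟩, ⟨0,0,1⟩⟩],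
  [⟨⟨0,896,928,928,960⟩, ⟨-6,-5,8⟩, ⟨-3,-2,4⟩⟩, ⟨⟨0,928,944,944,960⟩, ⟨-23,-16,32⟩, ⟨-11,-8,16⟩⟩,
   ⟨⟨0,932,936,960,964⟩, ⟨-45,-30,64⟩, ⟨-22,-15,32⟩⟩,
   ⟨⟨0,934,936,964,966⟩, ⟨-22,-15,32⟩, ⟨-44,-29,64⟩⟩,
   ⟨⟨0,936,944,960,976⟩, ⟨-11,-7,16⟩, ⟨-11,-6,16⟩⟩,
   ⟨⟨0,928,936,968,976⟩, ⟨-12,-7,16⟩, ⟨-6,-3,8⟩⟩,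
   ⟨⟨0,920,928,968,976⟩, ⟨-13,-7,16⟩, ⟨-13,-6,16⟩⟩, ⟨⟨0,912,920,960,976⟩, ⟨0,0,1⟩, ⟨0,0,1⟩⟩],
  [⟨⟨0,928,960,992,1024⟩, ⟨-2,-1,4⟩, ⟨-1,0,2⟩⟩, ⟨⟨0,960,976,992,1024⟩, ⟨-3,-1,8⟩, ⟨-3,0,8⟩⟩,
   ⟨⟨0,976,984,1008,1024⟩, ⟨-3,0,8⟩, ⟨-5,0,16⟩⟩, ⟨⟨0,976,992,1024,1040⟩, ⟨-3,1,8⟩, ⟨-2,1,8⟩⟩,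
   ⟨⟨0,976,992,1040,1056⟩, ⟨-3,2,8⟩, ⟨-1,1,4⟩⟩, ⟨⟨0,976,992,1056,1072⟩, ⟨-3,2,8⟩, ⟨-3,3,8⟩⟩,
   ⟨⟨0,960,976,1056,1088⟩, ⟨-1,1,2⟩, ⟨-7,8,16⟩⟩, ⟨⟨0,960,968,1088,1096⟩, ⟨-1,1,2⟩, ⟨-8,9,16⟩⟩,
   ⟨⟨0,944,960,1088,1104⟩, ⟨-5,4,8⟩, ⟨-5,5,8⟩⟩, ⟨⟨0,936,944,1088,1104⟩, ⟨-11,8,16⟩, ⟨-5,4,8⟩⟩,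
   ⟨⟨0,928,944,1056,1088⟩, ⟨-5,2,8⟩, ⟨-5,3,8⟩⟩, ⟨⟨0,944,952,1056,1072⟩, ⟨-5,2,8⟩, ⟨-9,4,16⟩⟩,
   ⟨⟨0,944,952,1040,1056⟩, ⟨-5,1,8⟩, ⟨-9,2,16⟩⟩, ⟨⟨0,944,960,1024,1040⟩, ⟨0,0,1⟩, ⟨0,0,1⟩⟩],
  [⟨⟨0,992,1024,928,960⟩, ⟨-1,-2,4⟩, ⟨0,-1,2⟩⟩, ⟨⟨0,992,1024,960,992⟩, ⟨-1,-2,8⟩, ⟨0,-1,4⟩⟩,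
   ⟨⟨0,1008,1024,992,1024⟩, ⟨0,-1,4⟩, ⟨0,0,1⟩⟩, ⟨⟨0,1024,1040,992,1024⟩, ⟨1,-2,8⟩, ⟨1,-1,8⟩⟩,
   ⟨⟨0,1040,1056,992,1008⟩, ⟨1,-2,8⟩, ⟨1,-1,4⟩⟩, ⟨⟨0,1040,1056,960,992⟩, ⟨1,-4,8⟩, ⟨1,-2,4⟩⟩,
   ⟨⟨0,1024,1056,928,960⟩, ⟨0,0,1⟩, ⟨0,0,1⟩⟩],
  [⟨⟨0,704,768,1152,1216⟩, ⟨-9,6,4⟩, ⟨-17,12,8⟩⟩, ⟨⟨0,736,752,1216,1232⟩, ⟨-9,6,4⟩, ⟨-18,13,8⟩⟩,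
   ⟨⟨0,704,736,1216,1280⟩, ⟨-9,7,4⟩, ⟨-9,8,4⟩⟩, ⟨⟨0,736,768,1248,1280⟩, ⟨-8,7,4⟩, ⟨-2,2,1⟩⟩,
   ⟨⟨0,768,784,1248,1280⟩, ⟨-15,14,8⟩, ⟨-15,16,8⟩⟩,
   ⟨⟨0,784,800,1248,1280⟩, ⟨-14,15,8⟩, ⟨-7,8,4⟩⟩,
   ⟨⟨0,800,808,1264,1280⟩, ⟨-27,30,16⟩, ⟨-27,32,16⟩⟩,
   ⟨⟨0,808,816,1264,1280⟩, ⟨-27,30,16⟩, ⟨-13,15,8⟩⟩,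
   ⟨⟨0,800,816,1248,1264⟩, ⟨-13,14,8⟩, ⟨-13,15,8⟩⟩,
   ⟨⟨0,816,832,1248,1264⟩, ⟨-6,7,4⟩, ⟨-12,15,8⟩⟩, ⟨⟨0,832,848,1248,1264⟩, ⟨-6,7,4⟩, ⟨-11,14,8⟩⟩,
   ⟨⟨0,832,864,1216,1248⟩, ⟨-3,3,2⟩, ⟨-5,6,4⟩⟩, ⟨⟨0,832,864,1184,1216⟩, ⟨-5,5,4⟩, ⟨-5,6,4⟩⟩,
   ⟨⟨0,864,896,1184,1216⟩, ⟨-5,5,4⟩, ⟨-4,5,4⟩⟩, ⟨⟨0,864,896,1152,1184⟩, ⟨-1,1,1⟩, ⟨-4,5,4⟩⟩,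
   ⟨⟨0,896,912,1152,1184⟩, ⟨-1,1,1⟩, ⟨-7,8,8⟩⟩, ⟨⟨0,896,912,1120,1152⟩, ⟨-29,24,32⟩, ⟨-7,6,8⟩⟩,
   ⟨⟨0,908,912,1112,1120⟩, ⟨-29,22,32⟩, ⟨-29,24,32⟩⟩,
   ⟨⟨0,904,908,1112,1120⟩, ⟨-15,11,16⟩, ⟨-15,12,16⟩⟩,
   ⟨⟨0,896,904,1104,1120⟩, ⟨-8,5,8⟩, ⟨-4,3,4⟩⟩, ⟨⟨0,864,896,1088,1120⟩, ⟨-5,3,4⟩, ⟨-9,6,8⟩⟩,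
   ⟨⟨0,864,880,1120,1136⟩, ⟨-5,3,4⟩, ⟨-10,7,8⟩⟩, ⟨⟨0,832,864,1088,1152⟩, ⟨-3,1,2⟩, ⟨-3,2,2⟩⟩,
   ⟨⟨0,768,832,1088,1152⟩, ⟨-7,4,4⟩, ⟨-3,2,2⟩⟩, ⟨⟨0,800,832,1152,1184⟩, ⟨-7,4,4⟩, ⟨-7,5,4⟩⟩,
   ⟨⟨0,768,800,1152,1184⟩, ⟨-8,5,4⟩, ⟨-15,10,8⟩⟩, ⟨⟨0,768,784,1184,1216⟩, ⟨0,0,1⟩, ⟨0,0,1⟩⟩],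
  [⟨⟨0,704,736,1376,1408⟩, ⟨-9,11,4⟩, ⟨-9,12,4⟩⟩, ⟨⟨0,736,768,1376,1408⟩, ⟨-9,11,4⟩, ⟨-8,11,4⟩⟩,
   ⟨⟨0,736,768,1344,1376⟩, ⟨-4,5,2⟩, ⟨-8,11,4⟩⟩, ⟨⟨0,768,800,1344,1376⟩, ⟨-4,5,2⟩, ⟨-7,10,4⟩⟩,
   ⟨⟨0,768,800,1312,1344⟩, ⟨-7,9,4⟩, ⟨-7,10,4⟩⟩, ⟨⟨0,800,816,1312,1344⟩, ⟨-7,9,4⟩, ⟨-13,18,8⟩⟩,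
   ⟨⟨0,800,816,1296,1312⟩, ⟨-13,17,8⟩, ⟨-13,18,8⟩⟩,
   ⟨⟨0,816,832,1296,1312⟩, ⟨-12,17,8⟩, ⟨-6,9,4⟩⟩,
   ⟨⟨0,832,848,1280,1312⟩, ⟨-11,16,8⟩, ⟨-11,17,8⟩⟩,
   ⟨⟨0,848,864,1280,1296⟩, ⟨-11,17,8⟩, ⟨-10,17,8⟩⟩,
   ⟨⟨0,848,864,1296,1312⟩, ⟨-11,18,8⟩, ⟨-5,9,4⟩⟩,
   ⟨⟨0,848,864,1312,1344⟩, ⟨-11,19,8⟩, ⟨-11,20,8⟩⟩,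
   ⟨⟨0,832,848,1328,1344⟩, ⟨-3,5,2⟩, ⟨-11,20,8⟩⟩, ⟨⟨0,832,896,1344,1408⟩, ⟨-3,5,2⟩, ⟨-6,11,4⟩⟩,
   ⟨⟨0,816,832,1344,1376⟩, ⟨-13,22,8⟩, ⟨-6,11,4⟩⟩,
   ⟨⟨0,800,832,1376,1408⟩, ⟨-14,23,8⟩, ⟨-7,12,4⟩⟩,
   ⟨⟨0,784,800,1392,1408⟩, ⟨-15,24,8⟩, ⟨-7,12,4⟩⟩, ⟨⟨0,768,896,1408,1536⟩, ⟨-8,13,4⟩, ⟨-4,7,2⟩⟩,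
   ⟨⟨0,752,768,1440,1472⟩, ⟨-17,27,8⟩, ⟨-17,28,8⟩⟩,
   ⟨⟨0,736,752,1456,1472⟩, ⟨-9,14,4⟩, ⟨-17,28,8⟩⟩, ⟨⟨0,736,768,1472,1536⟩, ⟨-9,14,4⟩, ⟨-9,15,4⟩⟩,
   ⟨⟨0,720,736,1472,1504⟩, ⟨-19,30,8⟩, ⟨-9,15,4⟩⟩, ⟨⟨0,704,736,1504,1536⟩, ⟨-20,31,8⟩, ⟨-5,8,2⟩⟩,
   ⟨⟨0,688,704,1520,1536⟩, ⟨-21,32,8⟩, ⟨-5,8,2⟩⟩,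
   ⟨⟨0,672,704,1536,1600⟩, ⟨-22,33,8⟩, ⟨-11,17,4⟩⟩,
   ⟨⟨0,664,672,1552,1568⟩, ⟨-45,68,16⟩, ⟨-11,17,4⟩⟩,
   ⟨⟨0,656,672,1568,1600⟩, ⟨-23,34,8⟩, ⟨-23,35,8⟩⟩,
   ⟨⟨0,648,656,1568,1584⟩, ⟨-47,70,16⟩, ⟨-23,35,8⟩⟩,
   ⟨⟨0,640,656,1584,1600⟩, ⟨-6,9,2⟩, ⟨-23,36,8⟩⟩, ⟨⟨0,640,704,1600,1664⟩, ⟨-6,9,2⟩, ⟨-12,19,4⟩⟩,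
   ⟨⟨0,624,640,1600,1632⟩, ⟨-25,37,8⟩, ⟨-25,38,8⟩⟩,
   ⟨⟨0,616,624,1616,1632⟩, ⟨-51,75,16⟩, ⟨-51,76,16⟩⟩,
   ⟨⟨0,608,616,1624,1632⟩, ⟨-13,19,4⟩, ⟨-51,76,16⟩⟩,
   ⟨⟨0,608,640,1632,1664⟩, ⟨-13,19,4⟩, ⟨-26,39,8⟩⟩,
   ⟨⟨0,600,608,1632,1648⟩, ⟨-53,77,16⟩, ⟨-53,78,16⟩⟩,
   ⟨⟨0,592,600,1640,1648⟩, ⟨-27,39,8⟩, ⟨-53,78,16⟩⟩,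
   ⟨⟨0,592,608,1648,1664⟩, ⟨-27,39,8⟩, ⟨-27,40,8⟩⟩,
   ⟨⟨0,584,592,1648,1664⟩, ⟨-55,79,16⟩, ⟨-55,80,16⟩⟩,
   ⟨⟨0,580,584,1656,1664⟩, ⟨-111,158,32⟩, ⟨-111,159,32⟩⟩,
   ⟨⟨0,578,580,1656,1660⟩, ⟨-223,318,64⟩, ⟨-111,159,32⟩⟩,
   ⟨⟨0,576,580,1660,1664⟩, ⟨-112,159,32⟩, ⟨-7,10,2⟩⟩,
   ⟨⟨0,574,576,1660,1664⟩, ⟨-225,318,64⟩, ⟨-112,159,32⟩⟩,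
   ⟨⟨0,572,576,1656,1660⟩, ⟨-113,158,32⟩, ⟨-56,79,16⟩⟩,
   ⟨⟨0,568,576,1648,1656⟩, ⟨-112,157,32⟩, ⟨-56,79,16⟩⟩,
   ⟨⟨0,576,578,1652,1656⟩, ⟨-112,157,32⟩, ⟨-223,314,64⟩⟩,
   ⟨⟨0,576,580,1648,1652⟩, ⟨-28,39,8⟩, ⟨-111,156,32⟩⟩,
   ⟨⟨0,576,584,1632,1648⟩, ⟨-55,76,16⟩, ⟨-55,77,16⟩⟩,
   ⟨⟨0,584,588,1632,1640⟩, ⟨-55,76,16⟩, ⟨-109,152,32⟩⟩,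
   ⟨⟨0,576,592,1600,1632⟩, ⟨-27,37,8⟩, ⟨-54,75,16⟩⟩,
   ⟨⟨0,592,600,1616,1624⟩, ⟨-27,37,8⟩, ⟨-53,74,16⟩⟩,
   ⟨⟨0,592,608,1600,1616⟩, ⟨-27,36,8⟩, ⟨-13,18,4⟩⟩,
   ⟨⟨0,576,608,1536,1600⟩, ⟨-26,35,8⟩, ⟨-13,18,4⟩⟩,
   ⟨⟨0,608,616,1584,1600⟩, ⟨-26,35,8⟩, ⟨-51,70,16⟩⟩,
   ⟨⟨0,608,624,1568,1584⟩, ⟨-25,34,8⟩, ⟨-25,35,8⟩⟩,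
   ⟨⟨0,624,632,1568,1584⟩, ⟨-25,34,8⟩, ⟨-49,68,16⟩⟩,
   ⟨⟨0,608,640,1536,1568⟩, ⟨-3,4,1⟩, ⟨-24,33,8⟩⟩, ⟨⟨0,640,656,1536,1552⟩, ⟨-3,4,1⟩, ⟨-23,32,8⟩⟩,
   ⟨⟨0,640,672,1472,1536⟩, ⟨-11,14,4⟩, ⟨-11,15,4⟩⟩,
   ⟨⟨0,672,688,1472,1504⟩, ⟨-21,28,8⟩, ⟨-21,29,8⟩⟩,
   ⟨⟨0,688,704,1472,1488⟩, ⟨-21,28,8⟩, ⟨-5,7,2⟩⟩, ⟨⟨0,640,704,1408,1472⟩, ⟨-10,13,4⟩, ⟨-5,7,2⟩⟩,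
   ⟨⟨0,704,720,1440,1472⟩, ⟨-10,13,4⟩, ⟨-19,26,8⟩⟩, ⟨⟨0,704,736,1408,1440⟩, ⟨0,0,1⟩, ⟨0,0,1⟩⟩],
  [⟨⟨0,1008,1024,1056,1088⟩, ⟨-1,4,8⟩, ⟨0,1,2⟩⟩, ⟨⟨0,1008,1024,1088,1120⟩, ⟨-1,4,8⟩, ⟨-1,5,8⟩⟩,
   ⟨⟨0,1000,1008,1088,1104⟩, ⟨-3,8,16⟩, ⟨-3,10,16⟩⟩,
   ⟨⟨0,992,1000,1088,1104⟩, ⟨-1,2,4⟩, ⟨-4,9,16⟩⟩, ⟨⟨0,988,992,1088,1096⟩, ⟨-9,18,32⟩, ⟨-4,9,16⟩⟩,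
   ⟨⟨0,984,992,1096,1104⟩, ⟨-5,9,16⟩, ⟨-5,10,16⟩⟩, ⟨⟨0,976,984,1096,1104⟩, ⟨-3,5,8⟩, ⟨-5,10,16⟩⟩,
   ⟨⟨0,976,992,1104,1120⟩, ⟨-3,5,8⟩, ⟨-3,6,8⟩⟩, ⟨⟨0,968,976,1104,1120⟩, ⟨-7,12,16⟩, ⟨-3,6,8⟩⟩,
   ⟨⟨0,960,976,1120,1152⟩, ⟨-1,2,2⟩, ⟨-3,8,8⟩⟩, ⟨⟨0,960,992,1152,1184⟩, ⟨-1,2,2⟩, ⟨-2,5,4⟩⟩,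
   ⟨⟨0,928,960,1152,1216⟩, ⟨-3,6,4⟩, ⟨-5,12,8⟩⟩, ⟨⟨0,928,944,1216,1248⟩, ⟨-3,7,4⟩, ⟨-11,28,16⟩⟩,
   ⟨⟨0,928,936,1248,1264⟩, ⟨-11,28,16⟩, ⟨-11,30,16⟩⟩,
   ⟨⟨0,936,944,1248,1264⟩, ⟨-5,14,8⟩, ⟨-5,15,8⟩⟩, ⟨⟨0,944,960,1248,1280⟩, ⟨-2,7,4⟩, ⟨-1,4,2⟩⟩,
   ⟨⟨0,960,992,1248,1280⟩, ⟨-3,14,8⟩, ⟨-1,7,4⟩⟩, ⟨⟨0,976,992,1216,1248⟩, ⟨-1,6,4⟩, ⟨-1,7,4⟩⟩,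
   ⟨⟨0,992,1024,1216,1280⟩, ⟨-1,6,4⟩, ⟨0,3,2⟩⟩, ⟨⟨0,992,1024,1184,1216⟩, ⟨-1,10,8⟩, ⟨0,5,4⟩⟩,
   ⟨⟨0,1008,1024,1152,1184⟩, ⟨0,1,1⟩, ⟨0,5,4⟩⟩, ⟨⟨0,1024,1088,1152,1280⟩, ⟨0,1,1⟩, ⟨1,4,4⟩⟩,
   ⟨⟨0,1024,1056,1120,1152⟩, ⟨0,3,4⟩, ⟨1,6,8⟩⟩, ⟨⟨0,1024,1040,1104,1120⟩, ⟨1,5,8⟩, ⟨1,6,8⟩⟩,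
   ⟨⟨0,1040,1056,1088,1120⟩, ⟨3,8,16⟩, ⟨7,16,32⟩⟩,
   ⟨⟨0,1048,1052,1084,1088⟩, ⟨13,30,64⟩, ⟨7,15,32⟩⟩,
   ⟨⟨0,1050,1052,1082,1084⟩, ⟨13,29,64⟩, ⟨27,58,128⟩⟩,
   ⟨⟨0,1050,1051,1080,1082⟩, ⟨13,28,64⟩, ⟨13,29,64⟩⟩,
   ⟨⟨0,1048,1050,1080,1082⟩, ⟨3,7,16⟩, ⟨12,29,64⟩⟩,
   ⟨⟨0,1044,1048,1080,1084⟩, ⟨5,14,32⟩, ⟨5,15,32⟩⟩, ⟨⟨0,1040,1044,1080,1088⟩, ⟨2,7,16⟩, ⟨1,4,8⟩⟩,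
   ⟨⟨0,1024,1040,1056,1088⟩, ⟨0,0,1⟩, ⟨0,0,1⟩⟩],
  [⟨⟨0,1216,1280,768,896⟩, ⟨3,-2,2⟩, ⟨2,-1,1⟩⟩, ⟨⟨0,1216,1280,896,960⟩, ⟨3,-2,2⟩, ⟨3,-1,2⟩⟩,
   ⟨⟨0,1184,1216,896,960⟩, ⟨5,-2,4⟩, ⟨3,-1,2⟩⟩, ⟨⟨0,1184,1216,960,992⟩, ⟨5,-1,4⟩, ⟨11,-2,8⟩⟩,
   ⟨⟨0,1184,1200,992,1008⟩, ⟨5,-1,4⟩, ⟨10,-1,8⟩⟩, ⟨⟨0,1168,1184,992,1024⟩, ⟨9,0,8⟩, ⟨19,0,16⟩⟩,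
   ⟨⟨0,1168,1176,1024,1032⟩, ⟨37,2,32⟩, ⟨75,4,64⟩⟩,
   ⟨⟨0,1172,1174,1032,1034⟩, ⟨37,2,32⟩, ⟨74,5,64⟩⟩,
   ⟨⟨0,1168,1172,1032,1036⟩, ⟨73,6,64⟩, ⟨37,3,32⟩⟩,
   ⟨⟨0,1170,1172,1036,1038⟩, ⟨147,14,128⟩, ⟨74,7,64⟩⟩,
   ⟨⟨0,1171,1172,1038,1040⟩, ⟨74,7,64⟩, ⟨37,4,32⟩⟩,
   ⟨⟨0,1172,1176,1036,1040⟩, ⟨38,3,32⟩, ⟨19,2,16⟩⟩,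
   ⟨⟨0,1176,1184,1032,1040⟩, ⟨20,1,16⟩, ⟨10,1,8⟩⟩, ⟨⟨0,1184,1216,1024,1056⟩, ⟨11,0,8⟩, ⟨3,0,2⟩⟩,
   ⟨⟨0,1200,1216,1008,1024⟩, ⟨12,-1,8⟩, ⟨3,0,2⟩⟩, ⟨⟨0,1216,1248,992,1024⟩, ⟨7,-1,4⟩, ⟨7,0,4⟩⟩,
   ⟨⟨0,1248,1280,960,1024⟩, ⟨4,-1,2⟩, ⟨2,0,1⟩⟩, ⟨⟨0,1280,1344,960,1024⟩, ⟨9,-2,4⟩, ⟨5,-1,2⟩⟩,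
   ⟨⟨0,1312,1344,928,960⟩, ⟨10,-3,4⟩, ⟨5,-1,2⟩⟩, ⟨⟨0,1344,1408,896,1024⟩, ⟨3,-1,1⟩, ⟨3,0,1⟩⟩,
   ⟨⟨0,1408,1536,896,1024⟩, ⟨13,-4,4⟩, ⟨7,-2,2⟩⟩, ⟨⟨0,1440,1472,832,896⟩, ⟨7,-3,2⟩, ⟨7,-2,2⟩⟩,
   ⟨⟨0,1472,1536,832,896⟩, ⟨8,-3,2⟩, ⟨4,-1,1⟩⟩, ⟨⟨0,1536,1792,768,1024⟩, ⟨19,-8,4⟩, ⟨5,-2,1⟩⟩,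
   ⟨⟨0,1632,1664,704,768⟩, ⟨10,-5,2⟩, ⟨5,-2,1⟩⟩, ⟨⟨0,1664,1728,704,768⟩, ⟨21,-10,4⟩, ⟨11,-5,2⟩⟩,
   ⟨⟨0,1696,1728,672,704⟩, ⟨22,-11,4⟩, ⟨11,-5,2⟩⟩, ⟨⟨0,1728,1792,640,768⟩, ⟨23,-12,4⟩, ⟨6,-3,1⟩⟩,
   ⟨⟨0,1760,1792,608,640⟩, ⟨24,-13,4⟩, ⟨6,-3,1⟩⟩, ⟨⟨0,1792,1920,512,640⟩, ⟨6,-4,1⟩, ⟨12,-7,2⟩⟩,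
   ⟨⟨0,1728,1792,512,576⟩, ⟨11,-7,2⟩, ⟨23,-14,4⟩⟩,
   ⟨⟨0,1728,1760,576,608⟩, ⟨11,-7,2⟩, ⟨22,-13,4⟩⟩, ⟨⟨0,1664,1728,512,640⟩, ⟨5,-4,1⟩, ⟨5,-3,1⟩⟩,
   ⟨⟨0,1536,1664,512,640⟩, ⟨4,-3,1⟩, ⟨9,-6,2⟩⟩, ⟨⟨0,1536,1600,640,704⟩, ⟨4,-3,1⟩, ⟨8,-5,2⟩⟩,
   ⟨⟨0,1472,1536,640,704⟩, ⟨7,-6,2⟩, ⟨7,-5,2⟩⟩, ⟨⟨0,1408,1472,640,768⟩, ⟨3,-3,1⟩, ⟨3,-2,1⟩⟩,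
   ⟨⟨0,1280,1408,512,768⟩, ⟨5,-4,2⟩, ⟨3,-2,1⟩⟩, ⟨⟨0,1344,1408,768,832⟩, ⟨5,-4,2⟩, ⟨5,-3,2⟩⟩,
   ⟨⟨0,1280,1344,768,896⟩, ⟨0,0,1⟩, ⟨0,0,1⟩⟩],
  [⟨⟨0,1052,1056,1072,1076⟩, ⟨15,26,64⟩, ⟨8,13,32⟩⟩,
   ⟨⟨0,1054,1056,1076,1078⟩, ⟨15,27,64⟩, ⟨31,54,128⟩⟩,
   ⟨⟨0,1054,1055,1078,1079⟩, ⟨31,54,128⟩, ⟨31,55,128⟩⟩,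
   ⟨⟨0,1055,1056,1078,1080⟩, ⟨16,27,64⟩, ⟨4,7,16⟩⟩,
   ⟨⟨0,1056,1060,1076,1080⟩, ⟨9,13,32⟩, ⟨9,14,32⟩⟩,
   ⟨⟨0,1060,1064,1072,1080⟩, ⟨5,6,16⟩, ⟨5,7,16⟩⟩, ⟨⟨0,1064,1072,1072,1088⟩, ⟨3,3,8⟩, ⟨3,4,8⟩⟩,
   ⟨⟨0,1072,1088,1072,1088⟩, ⟨7,6,16⟩, ⟨4,3,8⟩⟩, ⟨⟨0,1080,1088,1064,1072⟩, ⟨8,5,16⟩, ⟨4,3,8⟩⟩,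
   ⟨⟨0,1088,1120,1056,1088⟩, ⟨2,1,4⟩, ⟨3,1,4⟩⟩, ⟨⟨0,1088,1120,1024,1056⟩, ⟨1,0,2⟩, ⟨2,1,4⟩⟩,
   ⟨⟨0,1056,1088,1024,1056⟩, ⟨5,4,16⟩, ⟨3,2,8⟩⟩, ⟨⟨0,1064,1072,1056,1064⟩, ⟨5,4,16⟩, ⟨5,5,16⟩⟩,
   ⟨⟨0,1056,1064,1056,1072⟩, ⟨2,3,8⟩, ⟨17,24,64⟩⟩, ⟨⟨0,1056,1058,1072,1074⟩, ⟨0,0,1⟩, ⟨0,0,1⟩⟩],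
  [⟨⟨0,1136,1152,1040,1056⟩, ⟨7,2,8⟩, ⟨15,4,16⟩⟩,
   ⟨⟨0,1136,1144,1056,1072⟩, ⟨30,9,32⟩, ⟨15,5,16⟩⟩,
   ⟨⟨0,1144,1148,1060,1064⟩, ⟨31,9,32⟩, ⟨31,10,32⟩⟩,
   ⟨⟨0,1148,1152,1060,1064⟩, ⟨32,9,32⟩, ⟨16,5,16⟩⟩,
   ⟨⟨0,1152,1168,1056,1088⟩, ⟨17,4,16⟩, ⟨35,8,32⟩⟩,
   ⟨⟨0,1160,1164,1052,1056⟩, ⟨69,14,64⟩, ⟨35,7,32⟩⟩,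
   ⟨⟨0,1162,1164,1048,1052⟩, ⟨35,6,32⟩, ⟨35,7,32⟩⟩,
   ⟨⟨0,1164,1168,1048,1056⟩, ⟨35,6,32⟩, ⟨71,12,64⟩⟩,
   ⟨⟨0,1164,1166,1046,1048⟩, ⟨70,11,64⟩, ⟨141,22,128⟩⟩,
   ⟨⟨0,1164,1165,1044,1046⟩, ⟨35,5,32⟩, ⟨70,11,64⟩⟩,
   ⟨⟨0,1162,1164,1044,1046⟩, ⟨69,10,64⟩, ⟨69,11,64⟩⟩,
   ⟨⟨0,1160,1162,1044,1048⟩, ⟨34,5,32⟩, ⟨17,3,16⟩⟩,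
   ⟨⟨0,1152,1160,1040,1048⟩, ⟨16,3,16⟩, ⟨33,6,32⟩⟩, ⟨⟨0,1152,1156,1048,1052⟩, ⟨0,0,1⟩, ⟨0,0,1⟩⟩],
  [⟨⟨0,1168,1176,1104,1120⟩, ⟨19,10,16⟩, ⟨19,12,16⟩⟩,
   ⟨⟨0,1176,1184,1104,1120⟩, ⟨10,5,8⟩, ⟨5,3,4⟩⟩, ⟨⟨0,1184,1216,1088,1152⟩, ⟨3,1,2⟩, ⟨3,2,2⟩⟩,
   ⟨⟨0,1216,1248,1088,1152⟩, ⟨7,2,4⟩, ⟨7,4,4⟩⟩, ⟨⟨0,1248,1280,1088,1152⟩, ⟨7,4,4⟩, ⟨2,1,1⟩⟩,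
   ⟨⟨0,1248,1280,1152,1216⟩, ⟨2,1,1⟩, ⟨4,3,2⟩⟩, ⟨⟨0,1280,1344,1152,1280⟩, ⟨5,2,2⟩, ⟨5,4,2⟩⟩,
   ⟨⟨0,1344,1408,1152,1280⟩, ⟨5,4,2⟩, ⟨3,2,1⟩⟩, ⟨⟨0,1344,1408,1280,1344⟩, ⟨3,2,1⟩, ⟨6,5,2⟩⟩,
   ⟨⟨0,1408,1472,1280,1344⟩, ⟨6,5,2⟩, ⟨7,5,2⟩⟩, ⟨⟨0,1408,1472,1344,1408⟩, ⟨3,3,1⟩, ⟨7,6,2⟩⟩,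
   ⟨⟨0,1408,1472,1408,1536⟩, ⟨12,13,4⟩, ⟨6,7,2⟩⟩, ⟨⟨0,1392,1408,1440,1472⟩, ⟨23,28,8⟩, ⟨6,7,2⟩⟩,
   ⟨⟨0,1376,1408,1472,1536⟩, ⟨11,14,4⟩, ⟨11,15,4⟩⟩,
   ⟨⟨0,1344,1376,1472,1504⟩, ⟨5,7,2⟩, ⟨20,29,8⟩⟩,
   ⟨⟨0,1328,1344,1472,1488⟩, ⟨19,28,8⟩, ⟨19,29,8⟩⟩,
   ⟨⟨0,1320,1328,1472,1488⟩, ⟨37,56,16⟩, ⟨37,57,16⟩⟩,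
   ⟨⟨0,1312,1320,1472,1480⟩, ⟨9,14,4⟩, ⟨37,56,16⟩⟩,
   ⟨⟨0,1312,1344,1408,1472⟩, ⟨9,13,4⟩, ⟨9,14,4⟩⟩,
   ⟨⟨0,1296,1312,1440,1472⟩, ⟨17,26,8⟩, ⟨17,27,8⟩⟩,
   ⟨⟨0,1280,1296,1440,1456⟩, ⟨8,13,4⟩, ⟨17,26,8⟩⟩, ⟨⟨0,1280,1312,1408,1440⟩, ⟨2,3,1⟩, ⟨8,13,4⟩⟩,
   ⟨⟨0,1264,1280,1408,1440⟩, ⟨15,24,8⟩, ⟨2,3,1⟩⟩, ⟨⟨0,1216,1280,1280,1408⟩, ⟨3,4,2⟩, ⟨7,8,4⟩⟩,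
   ⟨⟨0,1216,1248,1248,1280⟩, ⟨6,7,4⟩, ⟨3,4,2⟩⟩, ⟨⟨0,1184,1216,1216,1280⟩, ⟨5,6,4⟩, ⟨3,3,2⟩⟩,
   ⟨⟨0,1152,1216,1152,1216⟩, ⟨1,1,1⟩, ⟨5,4,4⟩⟩, ⟨⟨0,1152,1184,1120,1152⟩, ⟨0,0,1⟩, ⟨0,0,1⟩⟩],
  [⟨⟨4,0,256,1024,1280⟩, ⟨0,-64,1⟩, ⟨-16,-64,1⟩⟩, ⟨⟨4,256,512,1024,1280⟩, ⟨0,-32,1⟩, ⟨-8,-32,1⟩⟩,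
   ⟨⟨4,512,768,1024,1280⟩, ⟨0,-64,3⟩, ⟨-16,-64,3⟩⟩,
   ⟨⟨4,768,1024,1024,1280⟩, ⟨0,-16,1⟩, ⟨-4,-16,1⟩⟩,
   ⟨⟨4,1024,1280,1024,1280⟩, ⟨0,-64,5⟩, ⟨-16,-64,5⟩⟩,
   ⟨⟨4,1280,1536,1024,1280⟩, ⟨0,-32,3⟩, ⟨-8,-32,3⟩⟩,
   ⟨⟨4,1536,1792,1024,1280⟩, ⟨0,-64,7⟩, ⟨-16,-64,7⟩⟩,
   ⟨⟨4,1792,2048,1024,1280⟩, ⟨-2,-8,1⟩, ⟨0,-8,1⟩⟩, ⟨⟨0,768,1024,0,256⟩, ⟨-3,-12,2⟩, ⟨-1,-6,1⟩⟩,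
   ⟨⟨0,832,896,256,384⟩, ⟨-3,-10,2⟩, ⟨-1,-5,1⟩⟩, ⟨⟨0,832,896,384,448⟩, ⟨-5,-18,4⟩, ⟨-2,-9,2⟩⟩,
   ⟨⟨0,864,896,448,512⟩, ⟨-5,-16,4⟩, ⟨-1,-4,1⟩⟩, ⟨⟨0,864,896,512,544⟩, ⟨-9,-30,8⟩, ⟨-4,-15,4⟩⟩,
   ⟨⟨0,880,896,544,576⟩, ⟨-9,-28,8⟩, ⟨-2,-7,2⟩⟩, ⟨⟨0,880,896,576,608⟩, ⟨-2,-7,2⟩, ⟨-4,-13,4⟩⟩,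
   ⟨⟨0,896,1024,512,640⟩, ⟨-1,-3,1⟩, ⟨-7,-24,8⟩⟩,
   ⟨⟨0,896,912,640,656⟩, ⟨-15,-46,16⟩, ⟨-7,-23,8⟩⟩,
   ⟨⟨0,904,912,656,672⟩, ⟨-15,-44,16⟩, ⟨-7,-22,8⟩⟩,
   ⟨⟨0,904,912,672,688⟩, ⟨-15,-42,16⟩, ⟨-7,-21,8⟩⟩,
   ⟨⟨0,904,912,688,696⟩, ⟨-7,-21,8⟩, ⟨-14,-41,16⟩⟩,
   ⟨⟨0,912,928,672,704⟩, ⟨-7,-20,8⟩, ⟨-3,-10,4⟩⟩,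
   ⟨⟨0,912,928,704,720⟩, ⟨-27,-76,32⟩, ⟨-13,-38,16⟩⟩,
   ⟨⟨0,916,920,720,728⟩, ⟨-27,-74,32⟩, ⟨-13,-37,16⟩⟩,
   ⟨⟨0,916,920,728,736⟩, ⟨-53,-144,64⟩, ⟨-13,-36,16⟩⟩,
   ⟨⟨0,918,920,736,740⟩, ⟨-53,-142,64⟩, ⟨-26,-71,32⟩⟩,
   ⟨⟨0,918,920,740,744⟩, ⟨-53,-140,64⟩, ⟨-105,-280,128⟩⟩,
   ⟨⟨0,918,919,744,746⟩, ⟨-53,-140,64⟩, ⟨-53,-139,64⟩⟩,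
   ⟨⟨0,916,918,744,748⟩, ⟨-27,-70,32⟩, ⟨-107,-280,128⟩⟩,
   ⟨⟨0,916,917,742,744⟩, ⟨-54,-141,64⟩, ⟨-27,-70,32⟩⟩,
   ⟨⟨0,912,916,736,744⟩, ⟨-7,-18,8⟩, ⟨-14,-35,16⟩⟩, ⟨⟨0,896,912,736,768⟩, ⟨-4,-9,4⟩, ⟨-7,-18,8⟩⟩,
   ⟨⟨0,896,912,720,736⟩, ⟨-15,-38,16⟩, ⟨-29,-76,32⟩⟩,
   ⟨⟨0,904,908,712,720⟩, ⟨-15,-39,16⟩, ⟨-15,-38,16⟩⟩,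
   ⟨⟨0,896,904,704,720⟩, ⟨-2,-5,2⟩, ⟨-15,-40,16⟩⟩, ⟨⟨0,896,904,688,704⟩, ⟨-8,-21,8⟩, ⟨-2,-5,2⟩⟩,
   ⟨⟨0,864,896,640,704⟩, ⟨-5,-12,4⟩, ⟨-9,-24,8⟩⟩, ⟨⟨0,864,880,608,640⟩, ⟨-5,-13,4⟩, ⟨-5,-12,4⟩⟩,
   ⟨⟨0,832,864,576,640⟩, ⟨-3,-7,2⟩, ⟨-5,-14,4⟩⟩, ⟨⟨0,832,864,512,576⟩, ⟨-3,-8,2⟩, ⟨-3,-7,2⟩⟩,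
   ⟨⟨0,768,832,512,640⟩, ⟨-2,-4,1⟩, ⟨-3,-8,2⟩⟩, ⟨⟨0,768,832,384,512⟩, ⟨-2,-5,1⟩, ⟨-2,-4,1⟩⟩,
   ⟨⟨0,640,768,384,512⟩, ⟨-5,-10,2⟩, ⟨-2,-5,1⟩⟩, ⟨⟨0,704,768,256,384⟩, ⟨-5,-12,2⟩, ⟨-5,-10,2⟩⟩,
   ⟨⟨0,640,704,256,384⟩, ⟨-3,-6,1⟩, ⟨-5,-12,2⟩⟩, ⟨⟨0,640,704,128,256⟩, ⟨-3,-7,1⟩, ⟨-3,-6,1⟩⟩,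
   ⟨⟨0,512,640,0,256⟩, ⟨-4,-8,1⟩, ⟨-3,-8,1⟩⟩,
   ⟨⟨4,1920,2048,1408,1536⟩, ⟨-48,-128,15⟩, ⟨-64,-128,15⟩⟩,
   ⟨⟨4,1792,1920,1408,1536⟩, ⟨-24,-64,7⟩, ⟨-32,-64,7⟩⟩,
   ⟨⟨4,1664,1792,1408,1536⟩, ⟨-48,-128,13⟩, ⟨-64,-128,13⟩⟩,
   ⟨⟨4,1536,1664,1408,1536⟩, ⟨-12,-32,3⟩, ⟨-16,-32,3⟩⟩,
   ⟨⟨4,1408,1536,1408,1536⟩, ⟨-48,-128,11⟩, ⟨-64,-128,11⟩⟩,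
   ⟨⟨4,1280,1408,1408,1536⟩, ⟨-24,-64,5⟩, ⟨-32,-64,5⟩⟩,
   ⟨⟨4,1152,1280,1408,1536⟩, ⟨-48,-128,9⟩, ⟨-64,-128,9⟩⟩,
   ⟨⟨4,1024,1152,1408,1536⟩, ⟨-6,-16,1⟩, ⟨-8,-16,1⟩⟩,
   ⟨⟨4,896,1024,1408,1536⟩, ⟨-48,-128,7⟩, ⟨-64,-128,7⟩⟩,
   ⟨⟨4,768,896,1408,1536⟩, ⟨-24,-64,3⟩, ⟨-32,-64,3⟩⟩,
   ⟨⟨4,640,768,1408,1536⟩, ⟨-48,-128,5⟩, ⟨-64,-128,5⟩⟩,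
   ⟨⟨4,512,640,1408,1536⟩, ⟨-12,-32,1⟩, ⟨-16,-32,1⟩⟩,
   ⟨⟨4,384,512,1408,1536⟩, ⟨-48,-128,3⟩, ⟨-64,-128,3⟩⟩,
   ⟨⟨4,256,384,1408,1536⟩, ⟨-24,-64,1⟩, ⟨-32,-64,1⟩⟩,
   ⟨⟨4,128,256,1408,1536⟩, ⟨-48,-128,1⟩, ⟨-64,-128,1⟩⟩, ⟨⟨4,0,128,1408,1536⟩, ⟨0,0,1⟩, ⟨0,0,1⟩⟩],
  [⟨⟨3,0,256,1024,1280⟩, ⟨0,64,1⟩, ⟨16,64,1⟩⟩, ⟨⟨3,256,512,1024,1280⟩, ⟨0,32,1⟩, ⟨8,32,1⟩⟩,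
   ⟨⟨3,512,768,1024,1280⟩, ⟨0,64,3⟩, ⟨16,64,3⟩⟩, ⟨⟨3,768,1024,1024,1280⟩, ⟨0,16,1⟩, ⟨4,16,1⟩⟩,
   ⟨⟨3,1024,1280,1024,1280⟩, ⟨0,64,5⟩, ⟨16,64,5⟩⟩, ⟨⟨3,1280,1536,1024,1280⟩, ⟨0,32,3⟩, ⟨8,32,3⟩⟩,
   ⟨⟨3,1536,1792,1024,1280⟩, ⟨0,64,7⟩, ⟨16,64,7⟩⟩, ⟨⟨3,1792,2048,1024,1280⟩, ⟨0,8,1⟩, ⟨2,8,1⟩⟩,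
   ⟨⟨0,1024,1280,1792,2048⟩, ⟨1,6,1⟩, ⟨3,12,2⟩⟩, ⟨⟨0,1152,1216,1664,1792⟩, ⟨1,5,1⟩, ⟨1,6,1⟩⟩,
   ⟨⟨0,1024,1152,1664,1792⟩, ⟨0,5,1⟩, ⟨1,5,1⟩⟩, ⟨⟨0,1024,1152,1536,1664⟩, ⟨1,8,2⟩, ⟨1,4,1⟩⟩,
   ⟨⟨0,1088,1152,1472,1536⟩, ⟨2,7,2⟩, ⟨1,4,1⟩⟩, ⟨⟨0,1152,1184,1472,1536⟩, ⟨2,7,2⟩, ⟨5,14,4⟩⟩,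
   ⟨⟨0,1152,1184,1440,1472⟩, ⟨5,13,4⟩, ⟨5,14,4⟩⟩, ⟨⟨0,1184,1216,1440,1472⟩, ⟨6,13,4⟩, ⟨3,7,2⟩⟩,
   ⟨⟨0,1216,1232,1440,1472⟩, ⟨13,26,8⟩, ⟨13,28,8⟩⟩,
   ⟨⟨0,1232,1248,1440,1472⟩, ⟨13,28,8⟩, ⟨7,14,4⟩⟩, ⟨⟨0,1216,1280,1472,1536⟩, ⟨4,7,2⟩, ⟨16,29,8⟩⟩,
   ⟨⟨0,1280,1288,1472,1488⟩, ⟨33,57,16⟩, ⟨33,58,16⟩⟩,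
   ⟨⟨0,1288,1296,1480,1488⟩, ⟨33,58,16⟩, ⟨17,29,8⟩⟩,
   ⟨⟨0,1280,1296,1488,1504⟩, ⟨17,29,8⟩, ⟨17,30,8⟩⟩,
   ⟨⟨0,1296,1304,1488,1504⟩, ⟨35,59,16⟩, ⟨35,60,16⟩⟩,
   ⟨⟨0,1304,1312,1496,1504⟩, ⟨35,60,16⟩, ⟨9,15,4⟩⟩,
   ⟨⟨0,1280,1312,1504,1536⟩, ⟨9,15,4⟩, ⟨9,16,4⟩⟩, ⟨⟨0,1312,1328,1504,1536⟩, ⟨9,16,4⟩, ⟨19,32,8⟩⟩,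
   ⟨⟨0,1280,1344,1536,1600⟩, ⟨10,17,4⟩, ⟨5,9,2⟩⟩, ⟨⟨0,1344,1376,1568,1600⟩, ⟨5,9,2⟩, ⟨11,18,4⟩⟩,
   ⟨⟨0,1344,1408,1600,1664⟩, ⟨5,10,2⟩, ⟨3,5,1⟩⟩, ⟨⟨0,1280,1408,1664,1792⟩, ⟨3,5,1⟩, ⟨3,6,1⟩⟩,
   ⟨⟨0,1408,1536,1664,1792⟩, ⟨3,6,1⟩, ⟨4,6,1⟩⟩, ⟨⟨0,1408,1536,1792,2048⟩, ⟨4,7,1⟩, ⟨4,8,1⟩⟩,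
   ⟨⟨0,1536,1664,1920,2048⟩, ⟨4,8,1⟩, ⟨5,8,1⟩⟩, ⟨⟨3,1536,2048,1536,2048⟩, ⟨16,32,3⟩, ⟨32,32,3⟩⟩,
   ⟨⟨3,1024,1536,1536,2048⟩, ⟨8,16,1⟩, ⟨16,16,1⟩⟩,
   ⟨⟨3,512,1024,1536,2048⟩, ⟨64,128,7⟩, ⟨8,16,1⟩⟩,
   ⟨⟨3,896,1024,1408,1536⟩, ⟨48,128,7⟩, ⟨64,128,7⟩⟩,
   ⟨⟨3,768,896,1408,1536⟩, ⟨24,64,3⟩, ⟨32,64,3⟩⟩,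
   ⟨⟨3,640,768,1408,1536⟩, ⟨48,128,5⟩, ⟨64,128,5⟩⟩,
   ⟨⟨3,512,640,1408,1536⟩, ⟨12,32,1⟩, ⟨16,32,1⟩⟩,
   ⟨⟨3,384,512,1408,1536⟩, ⟨48,128,3⟩, ⟨64,128,3⟩⟩,
   ⟨⟨3,256,384,1408,1536⟩, ⟨24,64,1⟩, ⟨32,64,1⟩⟩,
   ⟨⟨3,128,256,1408,1536⟩, ⟨48,128,1⟩, ⟨64,128,1⟩⟩, ⟨⟨3,0,128,1408,1536⟩, ⟨0,0,1⟩, ⟨0,0,1⟩⟩]]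

/-- The cells of the given chart. -/
def cellsOf (ch : ℕ) : List Cell := (loops.flatten.map Link.cell).filter fun k => Nat.beq k.ch ch

section

variable (σ τ : ℝ)

theorem bern₂_rootC : bern₂ rootC σ τ = 245 * chartPoly 0 σ τ + 5366275898770465 := by
  simp only [bern₂, V.bern, V.map, rootC, chartPoly, hom, chartX, chartY, chartW]
  push_cast
  ring

theorem bern₂_rootE : bern₂ rootE σ τ = 1225 * chartPoly 1 σ τ + 19009141473280000 := by
  simp only [bern₂, V.bern, V.map, rootE, chartPoly, hom, chartX, chartY, chartW]
  push_cast
  ring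

theorem bern₂_rootW : bern₂ rootW σ τ = 1225 * chartPoly 2 σ τ + 26831379493852325 := by
  simp only [bern₂, V.bern, V.map, rootW, chartPoly, hom, chartX, chartY, chartW]
  push_cast
  ring

theorem bern₂_rootN : bern₂ rootN σ τ = 1225 * chartPoly 3 σ τ + 19009141473280000 := by
  simp only [bern₂, V.bern, V.map, rootN, chartPoly, hom, chartX, chartY, chartW]
  push_cast
  ring

theorem bern₂_rootS : bern₂ rootS σ τ = 1225 * chartPoly 4 σ τ + 26831379493852325 := by
  simp only [bern₂, V.bern, V.map, rootS, chartPoly, hom, chartX, chartY, chartW]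
  push_cast
  ring

end

instance (k : Cell) (X Y W : ℤ) : Decidable (k.Mem X Y W) := inferInstanceAs (Decidable (_ ∧ _))

/-- The two points of a link lie in both cells, on different sides of the curve. -/
def Link.meets (l l' : Link) : Bool :=
  decide (0 < l.P.W ∧ 0 < l.Q.W ∧ l.cell.Mem l.P.X l.P.Y l.P.W ∧ l.cell.Mem l.Q.X l.Q.Y l.Q.W ∧
    l'.cell.Mem l.P.X l.P.Y l.P.W ∧ l'.cell.Mem l.Q.X l.Q.Y l.Q.W ∧
    homInt l.P.X l.P.Y l.P.W * homInt l.Q.X l.Q.Y l.Q.W < 0)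

def linkedFrom (l : Link) : List Link → Bool
  | [] => true
  | l' :: L => l.meets l' && linkedFrom l' L

/-- Consecutive cells of the list share a point of the curve. -/
def linked : List Link → Bool
  | l :: l' :: L => linkedFrom l (l' :: L)
  | _ => false

/-- Cells of the same chart are disjoint. -/
def Cell.apart₀ (k l : Cell) : Bool :=
  Nat.blt k.b l.a || Nat.blt l.b k.a || Nat.blt k.d l.c || Nat.blt l.d k.c

/-- A cell of chart `3` is disjoint from a cell of chart `0`. -/
def Cell.apart₃ (k l : Cell) : Bool :=
  Nat.ble k.b 2048 && Nat.ble l.d 2048 &&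
    (Nat.blt k.b 2048 || Nat.blt l.d 2048 || Nat.blt k.d l.a || Nat.blt l.b k.c)

/-- A cell of chart `4` is disjoint from a cell of chart `0`. -/
def Cell.apart₄ (k l : Cell) : Bool :=
  Nat.ble k.b 2048 &&
    (Nat.blt k.b 2048 || Nat.blt 0 l.c || Nat.blt (k.d + l.b) 2048 || Nat.blt 2048 (k.c + l.a))

/-- A sufficient condition for cells to be disjoint. -/
def Cell.apart (k l : Cell) : Bool :=
  bif Nat.beq k.ch l.ch then k.apart₀ l
  else match k.ch, l.ch with
  | 0, 3 => l.apart₃ k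
  | 0, 4 => l.apart₄ k
  | 3, 0 => k.apart₃ l
  | 4, 0 => k.apart₄ l
  | 3, 4 => true
  | 4, 3 => true
  | _, _ => false

def allApart (L : List Link) : List (List Link) → Bool
  | [] => true
  | L' :: S => (L.all fun l => L'.all fun l' => l.cell.apart l'.cell) && allApart L S

def pairwiseApart : List (List Link) → Bool
  | [] => true
  | L :: S => allApart L S && pairwiseApart S

set_option maxRecDepth 100000 in
theorem cover_rootC :
    cover 30 rootC 5366275898770465 ⟨0, 0, 2048, 0, 2048⟩ (cellsOf 0) = true := by
  decide +kernel

set_option maxRecDepth 100000 in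
theorem cover_rootE :
    cover 30 rootE 19009141473280000 ⟨1, 0, 2048, 0, 2048⟩ (cellsOf 1) = true := by
  decide +kernel

set_option maxRecDepth 100000 in
theorem cover_rootW :
    cover 30 rootW 26831379493852325 ⟨2, 0, 2048, 0, 2048⟩ (cellsOf 2) = true := by
  decide +kernel

set_option maxRecDepth 100000 in
theorem cover_rootN :
    cover 30 rootN 19009141473280000 ⟨3, 0, 2048, 0, 2048⟩ (cellsOf 3) = true := by
  decide +kernel

set_option maxRecDepth 100000 in
theorem cover_rootS :
    cover 30 rootS 26831379493852325 ⟨4, 0, 2048, 0, 2048⟩ (cellsOf 4) = true := by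
  decide +kernel

set_option maxRecDepth 100000 in
theorem linked_loops : loops.all linked = true := by decide +kernel

set_option maxRecDepth 100000 in
theorem pairwiseApart_loops : pairwiseApart loops = true := by decide +kernel

set_option maxRecDepth 100000 in
theorem bounded_loops : ((loops.take 11).all fun L => L.all fun l =>
    Nat.beq l.cell.ch 0 && Nat.ble l.cell.b 2048 && Nat.ble l.cell.d 2048) = true := by
  decide +kernel

set_option maxRecDepth 100000 in
theorem ch_loops : (loops.all fun L => L.all fun l => Nat.blt l.cell.ch 5) = true := by
  decide +kernel

section

open Set

/-- The point with the given homogeneous coordinates. -/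
noncomputable def Pt.toProd (P : Pt) : ℝ × ℝ := (P.X / P.W, P.Y / P.W)

theorem Cell.Mem.toProd_mem {k : Cell} {P : Pt} (h : k.Mem P.X P.Y P.W) (hW : 0 < P.W) :
    P.toProd ∈ k.set := by
  have hW' : (0 : ℝ) < P.W := mod_cast hW
  have h' := h.cast.add h.cast (inv_nonneg.2 hW'.le) le_rfl
  simp only [zero_mul, add_zero, inv_mul_cancel₀ hW'.ne'] at h'
  simpa only [Cell.set, mem_ofPred_eq, Pt.toProd, div_eq_inv_mul] using h'

theorem cast_homInt_eq {P : Pt} (hW : 0 < P.W) :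
    (homInt P.X P.Y P.W : ℝ) = hom P.toProd.1 P.toProd.2 1 * P.W ^ 8 := by
  have hW' : (P.W : ℝ) ≠ 0 := mod_cast hW.ne'
  rw [cast_homInt, hom_mul_pow, Pt.toProd, div_mul_cancel₀ _ hW', div_mul_cancel₀ _ hW']

theorem Link.inter_nonempty_of_meets {l l' : Link} (h : l.meets l' = true) :
    (Z ∩ (l.cell.set ∩ l'.cell.set)).Nonempty := by
  obtain ⟨hP, hQ, hlP, hlQ, hP', hQ', hn⟩ := of_decide_eq_true h
  have hn' : (homInt l.P.X l.P.Y l.P.W : ℝ) * homInt l.Q.X l.Q.Y l.Q.W < 0 := mod_cast hn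
  rw [cast_homInt_eq hP, cast_homInt_eq hQ] at hn'
  have hp : (0 : ℝ) < (l.P.W : ℝ) ^ 8 * (l.Q.W : ℝ) ^ 8 := by
    have : (0 : ℝ) < l.P.W := mod_cast hP
    have : (0 : ℝ) < l.Q.W := mod_cast hQ
    positivity
  rw [mul_mul_mul_comm] at hn'
  have hc := (l.cell.convex_set.inter l'.cell.convex_set).isPreconnected
  have hmP : l.P.toProd ∈ l.cell.set ∩ l'.cell.set := ⟨hlP.toProd_mem hP, hP'.toProd_mem hP⟩
  have hmQ : l.Q.toProd ∈ l.cell.set ∩ l'.cell.set := ⟨hlQ.toProd_mem hQ, hQ'.toProd_mem hQ⟩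
  have key : (0 : ℝ) ∈ (fun p : ℝ × ℝ => hom p.1 p.2 1) '' (l.cell.set ∩ l'.cell.set) := by
    rcases mul_neg_iff.1 (neg_of_mul_neg_left hn' hp.le) with h | h
    · exact hc.intermediate_value hmQ hmP continuous_hom.continuousOn ⟨h.2.le, h.1.le⟩
    · exact hc.intermediate_value hmP hmQ continuous_hom.continuousOn ⟨h.1.le, h.2.le⟩
  obtain ⟨p, hp, hz⟩ := key
  exact ⟨p, mem_Z_iff.2 hz, hp⟩

/-- The part of the curve in the cells of a list. -/
def curve (L : List Link) : Set (ℝ × ℝ) := ⋃ l ∈ L, Z ∩ l.cell.set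

theorem mem_curve {L : List Link} {p : ℝ × ℝ} : p ∈ curve L ↔ p ∈ Z ∧ ∃ l ∈ L, p ∈ l.cell.set := by
  simp only [curve, mem_iUnion, mem_inter_iff, exists_prop]
  tauto

theorem isClosed_curve (L : List Link) : IsClosed (curve L) :=
  (List.finite_toSet L).isClosed_biUnion fun l _ => isClosed_Z.inter l.cell.isClosed_set

theorem curve_cons (l : Link) (L : List Link) : curve (l :: L) = Z ∩ l.cell.set ∪ curve L := by
  ext p
  simp only [mem_curve, List.mem_cons, exists_eq_or_imp, mem_union, mem_inter_iff]
  tauto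

theorem isPreconnected_curve_of_linkedFrom {l : Link} {L : List Link}
    (h : linkedFrom l L = true) (hc : ∀ l' ∈ l :: L, IsPreconnected (Z ∩ l'.cell.set)) :
    IsPreconnected (curve (l :: L)) := by
  induction L generalizing l with
  | nil => simpa [curve] using hc
  | cons l' L ih =>
    rw [linkedFrom, Bool.and_eq_true] at h
    obtain ⟨p, hpZ, hp, hp'⟩ := Link.inter_nonempty_of_meets h.1
    rw [curve_cons]
    exact (hc l List.mem_cons_self).union p ⟨hpZ, hp⟩
      (mem_curve.2 ⟨hpZ, l', List.mem_cons_self, hp'⟩)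
      (ih h.2 fun x hx => hc x (List.mem_cons_of_mem _ hx))

theorem isConnected_curve_of_linked {L : List Link} (h : linked L = true)
    (hc : ∀ l ∈ L, IsPreconnected (Z ∩ l.cell.set)) : IsConnected (curve L) := by
  rcases L with _ | ⟨l, _ | ⟨l', L⟩⟩
  · simp [linked] at h
  · simp [linked] at h
  · refine ⟨?_, isPreconnected_curve_of_linkedFrom h hc⟩
    simp only [linked, linkedFrom, Bool.and_eq_true] at h
    obtain ⟨p, hpZ, hp, -⟩ := Link.inter_nonempty_of_meets h.1
    exact ⟨p, mem_curve.2 ⟨hpZ, l, List.mem_cons_self, hp⟩⟩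

theorem Cell.disjoint_of_apart₃ {k l : Cell} (hk : k.ch = 3) (hl : l.ch = 0)
    (h : k.apart₃ l = true) : Disjoint k.set l.set := by
  rw [Set.disjoint_left]
  rintro p ⟨h0, h1, h2, h3, h4⟩ ⟨-, h1', h2', h3', h4'⟩
  simp only [hk, hl, formS, formT, formD] at *
  simp only [Cell.apart₃, Bool.and_eq_true, Bool.or_eq_true, Nat.ble_eq, Nat.blt_eq] at h
  obtain ⟨⟨hb, hd⟩, h⟩ := h
  have hb' : (k.b : ℝ) ≤ 2048 := mod_cast hb
  have hd' : (l.d : ℝ) ≤ 2048 := mod_cast hd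
  have hy : p.2 = 8 := by nlinarith
  rw [hy] at h1 h2 h3 h4 h3' h4'
  rcases h with ((h | h) | h) | h
  · have : (k.b : ℝ) < 2048 := mod_cast h
    linarith
  · have : (l.d : ℝ) < 2048 := mod_cast h
    linarith
  · have : (k.d : ℝ) < l.a := mod_cast h
    linarith
  · have : (l.b : ℝ) < k.c := mod_cast h
    linarith

theorem Cell.disjoint_of_apart₄ {k l : Cell} (hk : k.ch = 4) (hl : l.ch = 0)
    (h : k.apart₄ l = true) : Disjoint k.set l.set := by
  rw [Set.disjoint_left]
  rintro p ⟨h0, h1, h2, h3, h4⟩ ⟨-, h1', h2', h3', h4'⟩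
  simp only [hk, hl, formS, formT, formD] at *
  simp only [Cell.apart₄, Bool.and_eq_true, Bool.or_eq_true, Nat.ble_eq, Nat.blt_eq] at h
  obtain ⟨hb, h⟩ := h
  have hb' : (k.b : ℝ) ≤ 2048 := mod_cast hb
  have hc' : (0 : ℝ) ≤ l.c := Nat.cast_nonneg _
  have hy : p.2 = -8 := by nlinarith
  rw [hy] at h1 h2 h3 h4 h3' h4'
  rcases h with ((h | h) | h) | h
  · have : (k.b : ℝ) < 2048 := mod_cast h
    linarith
  · have : (0 : ℝ) < l.c := mod_cast h
    linarith
  · have : (k.d + l.b : ℝ) < 2048 := mod_cast h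
    linarith
  · have : (2048 : ℝ) < k.c + l.a := mod_cast h
    linarith

theorem Cell.formD_pos {k : Cell} {p : ℝ × ℝ} (hp : p ∈ k.set) : 0 < formD k.ch p.1 p.2 1 := by
  obtain ⟨s, t, -, -, -, -, hW, rfl⟩ := Cell.mem_set_iff.1 hp
  exact (form_chart t hW).1

theorem Cell.disjoint_of_apart₀ {k l : Cell} (hkl : k.ch = l.ch) (h : k.apart₀ l = true) :
    Disjoint k.set l.set := by
  rw [Set.disjoint_left]
  intro p hp hp'
  have hD := Cell.formD_pos hp
  obtain ⟨-, h1, h2, h3, h4⟩ := hp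
  obtain ⟨-, h1', h2', h3', h4'⟩ := hp'
  rw [hkl] at hD h1 h2 h3 h4
  have key {m n : ℕ} {z : ℝ} (hmn : m < n) (hm : z ≤ m * formD l.ch p.1 p.2 1)
      (hn : n * formD l.ch p.1 p.2 1 ≤ z) : False := by
    have := mul_lt_mul_of_pos_right (Nat.cast_lt (α := ℝ).2 hmn) hD
    linarith
  simp only [Cell.apart₀, Bool.or_eq_true, Nat.blt_eq] at h
  rcases h with ((h | h) | h) | h
  · exact key h h2 h1'
  · exact key h h2' h1
  · exact key h h4 h3'
  · exact key h h4' h3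

theorem Cell.disjoint_three_four {k l : Cell} (hk : k.ch = 3) (hl : l.ch = 4) :
    Disjoint k.set l.set := by
  rw [Set.disjoint_left]
  intro p hp hp'
  have h := Cell.formD_pos hp
  have h' := Cell.formD_pos hp'
  simp only [hk, hl, formD] at h h'
  linarith

theorem Cell.disjoint_of_apart {k l : Cell} (h : k.apart l = true) : Disjoint k.set l.set := by
  rw [Cell.apart, Bool.cond_eq_ite] at h
  split_ifs at h with hkl
  · exact Cell.disjoint_of_apart₀ (by simpa using hkl) h
  · split at h
    · exact (Cell.disjoint_of_apart₃ ‹_› ‹_› h).symm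
    · exact (Cell.disjoint_of_apart₄ ‹_› ‹_› h).symm
    · exact Cell.disjoint_of_apart₃ ‹_› ‹_› h
    · exact Cell.disjoint_of_apart₄ ‹_› ‹_› h
    · exact Cell.disjoint_three_four ‹_› ‹_›
    · exact (Cell.disjoint_three_four ‹_› ‹_›).symm
    · simp at h

theorem disjoint_curve_of_allApart {L L' : List Link} {S : List (List Link)}
    (h : allApart L S = true) (hL' : L' ∈ S) : Disjoint (curve L) (curve L') := by
  induction S with
  | nil => simp at hL'
  | cons L'' S ih =>
    rw [allApart, Bool.and_eq_true] at h
    rcases List.mem_cons.1 hL' with rfl | hL'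
    · rw [Set.disjoint_left]
      intro p hp hp'
      obtain ⟨-, l, hl, hpl⟩ := mem_curve.1 hp
      obtain ⟨-, l', hl', hpl'⟩ := mem_curve.1 hp'
      have := List.all_eq_true.1 (List.all_eq_true.1 h.1 l hl) l' hl'
      exact Set.disjoint_left.1 (Cell.disjoint_of_apart this) hpl hpl'
    · exact ih h.2 hL'

theorem pairwise_disjoint_curve {S : List (List Link)} (h : pairwiseApart S = true) :
    S.Pairwise fun L L' => Disjoint (curve L) (curve L') := by
  induction S with
  | nil => exact .nil
  | cons L S ih =>
    rw [pairwiseApart, Bool.and_eq_true] at h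
    exact .cons (fun L' hL' => disjoint_curve_of_allApart h.1 hL') (ih h.2)

end

section

open Set Filter Topology

theorem Cell.exists_mem_root (p : ℝ × ℝ) : ∃ ch < 5, p ∈ (⟨ch, 0, 2048, 0, 2048⟩ : Cell).set := by
  have hx := abs_cases p.1
  have hy := abs_cases p.2
  by_cases h : |p.1| ≤ 8 ∧ |p.2| ≤ 8
  · refine ⟨0, by norm_num, ?_⟩
    simp only [Cell.set, Cell.Mem, mem_ofPred_eq, formS, formT, formD]
    obtain ⟨h, h'⟩ := h
    rw [abs_le] at h h'
    refine ⟨?_, ?_, ?_, ?_, ?_⟩ <;> push_cast <;> linarith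
  have h : 8 < |p.1| ∨ 8 < |p.2| := by
    rwa [not_and_or, not_le, not_le] at h
  rcases le_total |p.2| |p.1| with hxy | hxy
  · have h8 : 8 < |p.1| := h.elim id hxy.trans_lt'
    rcases hx with hx | hx
    on_goal 1 => refine ⟨1, by norm_num, ?_⟩
    on_goal 2 => refine ⟨2, by norm_num, ?_⟩
    all_goals
      simp only [Cell.set, Cell.Mem, mem_ofPred_eq, formS, formT, formD]
      rw [hx.1, abs_le] at hxy
      refine ⟨?_, ?_, ?_, ?_, ?_⟩ <;> push_cast <;> linarith
  · have h8 : 8 < |p.2| := h.elim hxy.trans_lt' id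
    rcases hy with hy | hy
    on_goal 1 => refine ⟨3, by norm_num, ?_⟩
    on_goal 2 => refine ⟨4, by norm_num, ?_⟩
    all_goals
      simp only [Cell.set, Cell.Mem, mem_ofPred_eq, formS, formT, formD]
      rw [hy.1, abs_le] at hxy
      refine ⟨?_, ?_, ?_, ?_, ?_⟩ <;> push_cast <;> linarith

theorem represents_root {q : V (V ℕ)} {M ch : ℕ} {C : ℝ} (hC : C ≠ 0)
    (h : ∀ σ τ, bern₂ q σ τ = C * chartPoly ch σ τ + M) :
    Represents q M ⟨ch, 0, 2048, 0, 2048⟩ := by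
  refine ⟨C, hC, fun σ τ => ?_⟩
  rw [h]
  congr <;> push_cast <;> ring

theorem cellsOf_sound {ch : ℕ} (hch : ch < 5) :
    (∀ k ∈ cellsOf ch, IsPreconnected (Z ∩ k.set)) ∧
      ∀ p ∈ Z ∩ (⟨ch, 0, 2048, 0, 2048⟩ : Cell).set, ∃ k ∈ cellsOf ch, p ∈ k.set := by
  interval_cases ch
  · exact cover_sound 30 cover_rootC (represents_root (C := 245) (by norm_num)
      (by simpa using bern₂_rootC)) (by norm_num) (by norm_num)
  · exact cover_sound 30 cover_rootE (represents_root (C := 1225) (by norm_num)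
      (by simpa using bern₂_rootE)) (by norm_num) (by norm_num)
  · exact cover_sound 30 cover_rootW (represents_root (C := 1225) (by norm_num)
      (by simpa using bern₂_rootW)) (by norm_num) (by norm_num)
  · exact cover_sound 30 cover_rootN (represents_root (C := 1225) (by norm_num)
      (by simpa using bern₂_rootN)) (by norm_num) (by norm_num)
  · exact cover_sound 30 cover_rootS (represents_root (C := 1225) (by norm_num)
      (by simpa using bern₂_rootS)) (by norm_num) (by norm_num)

theorem mem_cellsOf {ch : ℕ} {k : Cell} :
    k ∈ cellsOf ch ↔ (∃ L ∈ loops, ∃ l ∈ L, l.cell = k) ∧ k.ch = ch := by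
  simp only [cellsOf, List.mem_filter, List.mem_map, List.mem_flatten, Nat.beq_eq]
  refine and_congr_left' ⟨?_, ?_⟩
  · rintro ⟨l, ⟨L, hL, hl⟩, rfl⟩
    exact ⟨L, hL, l, hl, rfl⟩
  · rintro ⟨L, hL, l, hl, rfl⟩
    exact ⟨l, ⟨L, hL, hl⟩, rfl⟩

theorem isConnected_curve {L : List Link} (hL : L ∈ loops) : IsConnected (curve L) := by
  refine isConnected_curve_of_linked (List.all_eq_true.1 linked_loops L hL) fun l hl => ?_
  have hch : l.cell.ch < 5 := by
    simpa using List.all_eq_true.1 (List.all_eq_true.1 ch_loops L hL) l hl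
  exact (cellsOf_sound hch).1 _ (mem_cellsOf.2 ⟨⟨L, hL, l, hl, rfl⟩, rfl⟩)

theorem exists_mem_curve {p : ℝ × ℝ} (hp : p ∈ Z) : ∃ L ∈ loops, p ∈ curve L := by
  obtain ⟨ch, hch, hpc⟩ := Cell.exists_mem_root p
  obtain ⟨k, hk, hpk⟩ := (cellsOf_sound hch).2 p ⟨hp, hpc⟩
  obtain ⟨⟨L, hL, l, hl, rfl⟩, -⟩ := mem_cellsOf.1 hk
  exact ⟨L, hL, mem_curve.2 ⟨hp, l, hl, hpk⟩⟩

theorem isBounded_curve {L : List Link} (hL : L ∈ loops.take 11) :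
    Bornology.IsBounded (curve L) := by
  refine (Metric.isBounded_Icc ((-8, -8) : ℝ × ℝ) (8, 8)).subset fun p hp => ?_
  obtain ⟨-, l, hl, -, h1, h2, h3, h4⟩ := mem_curve.1 hp
  have h := List.all_eq_true.1 (List.all_eq_true.1 bounded_loops L hL) l hl
  simp only [Bool.and_eq_true, Nat.beq_eq, Nat.ble_eq] at h
  obtain ⟨⟨hch, hb⟩, hd⟩ := h
  simp only [hch, formS, formT, formD] at h1 h2 h3 h4
  have ha : (0 : ℝ) ≤ l.cell.a := Nat.cast_nonneg _
  have hc : (0 : ℝ) ≤ l.cell.c := Nat.cast_nonneg _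
  have hb' : (l.cell.b : ℝ) ≤ 2048 := mod_cast hb
  have hd' : (l.cell.d : ℝ) ≤ 2048 := mod_cast hd
  refine ⟨⟨?_, ?_⟩, ?_, ?_⟩ <;> dsimp only <;> linarith

/-- The curve leaves the cell through the line at infinity. -/
def Cell.atInfinity (k : Cell) : Bool :=
  decide ((k.ch = 3 ∨ k.ch = 4) ∧ k.a = 0 ∧ 0 < k.b ∧ k.c ≤ k.d ∧
    homInt (k.c - 1024) 1024 0 * homInt (k.d - 1024) 1024 0 < 0)

theorem chartPoly_zero {ch : ℕ} (hch : ch = 3 ∨ ch = 4) (m : ℕ) :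
    chartPoly ch 0 (m / 2048) * 128 ^ 8 = homInt (m - 1024) 1024 0 := by
  rw [cast_homInt]
  rcases hch with rfl | rfl <;>
    simp only [chartPoly, chartX, chartY, chartW, hom] <;> push_cast <;> ring

theorem continuous_chartPoly (ch : ℕ) : Continuous fun p : ℝ × ℝ => chartPoly ch p.1 p.2 := by
  have hX := continuous_chartX ch
  have hY := continuous_chartY ch
  have hW := (continuous_chartW ch).comp (continuous_fst (Y := ℝ))
  simp only [Function.comp_def] at hW
  unfold chartPoly hom
  fun_prop

theorem Cell.not_isBounded_of_atInfinity {k : Cell} (h : k.atInfinity = true) :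
    ¬Bornology.IsBounded (Z ∩ k.set) := by
  simp only [Cell.atInfinity, decide_eq_true_eq] at h
  obtain ⟨hch, ha, hb, hcd, hn⟩ := h
  rw [isBounded_iff_forall_norm_le]
  rintro ⟨R, hR⟩
  have hn' : chartPoly k.ch 0 (k.c / 2048) * chartPoly k.ch 0 (k.d / 2048) < 0 := by
    have hn' : (homInt (k.c - 1024) 1024 0 : ℝ) * homInt (k.d - 1024) 1024 0 < 0 := mod_cast hn
    rw [← chartPoly_zero hch, ← chartPoly_zero hch] at hn'
    linarith
  have hcont (t : ℝ) := (continuous_chartPoly k.ch).comp (Continuous.prodMk_left t)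
  simp only [Function.comp_def] at hcont
  have hb' : (0 : ℝ) < k.b / 2048 := by positivity
  have hR' : (0 : ℝ) < 8 / (|R| + 1) := by positivity
  have hneg : ∀ᶠ s in 𝓝 0, chartPoly k.ch s (k.c / 2048) * chartPoly k.ch s (k.d / 2048) < 0 :=
    ((hcont _).mul (hcont _)).continuousAt.eventually_lt continuousAt_const hn'
  have hsmall := hneg.and ((eventually_lt_nhds hb').and (eventually_lt_nhds hR'))
  obtain ⟨s, ⟨hs, hsb, hsR⟩, hs0⟩ :=
    ((hsmall.filter_mono nhdsWithin_le_nhds).and (self_mem_nhdsWithin (s := Ioi 0))).exists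
  have hW : 0 < chartW k.ch s := by
    rcases hch with h | h <;> simpa only [h, chartW]
  have hc := (continuous_chartPoly k.ch).comp (Continuous.prodMk_right s)
  simp only [Function.comp_def] at hc
  have hle : (k.c / 2048 : ℝ) ≤ k.d / 2048 := by gcongr
  have hmem : (0 : ℝ) ∈ uIcc (chartPoly k.ch s (k.c / 2048)) (chartPoly k.ch s (k.d / 2048)) := by
    rw [mem_uIcc]
    rcases mul_neg_iff.1 hs with h | h
    · exact .inr ⟨h.2.le, h.1.le⟩
    · exact .inl ⟨h.1.le, h.2.le⟩
  obtain ⟨t, ht, hz⟩ := intermediate_value_uIcc hc.continuousOn hmem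
  rw [uIcc_of_le hle] at ht
  obtain ⟨ht1, ht2⟩ := ht
  have hp := hR (chart k.ch s t) ⟨(chart_mem_Z_iff hW).2 hz, Cell.mem_set_iff.2
    ⟨s, t, by rw [ha, Nat.cast_zero]; linarith, by linarith, by linarith, by linarith, hW, rfl⟩⟩
  have h8 : |(chart k.ch s t).2| = 8 / s := by
    rcases hch with h | h <;> simp [h, chart, chartY, chartW, abs_div, abs_of_pos hs0]
  have hle' := (norm_snd_le (chart k.ch s t)).trans hp
  rw [Real.norm_eq_abs, h8, div_le_iff₀ hs0] at hle'
  rw [lt_div_iff₀ (by positivity)] at hsR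
  nlinarith [le_abs_self R]

set_option maxRecDepth 100000 in
theorem atInfinity_loops :
    ((loops.drop 11).all fun L => L.any fun l => l.cell.atInfinity) = true := by
  decide +kernel

theorem not_isBounded_curve {L : List Link} (hL : L ∈ loops.drop 11) :
    ¬Bornology.IsBounded (curve L) := by
  obtain ⟨l, hl, h⟩ := List.any_eq_true.1 (List.all_eq_true.1 atInfinity_loops L hL)
  refine fun hb => Cell.not_isBounded_of_atInfinity h (hb.subset fun p hp => ?_)
  exact mem_curve.2 ⟨hp.1, l, hl, hp.2⟩

theorem connectedComponentIn_iUnion {ι X : Type*} [Finite ι] [TopologicalSpace X] {C : ι → Set X}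
    (hcl : ∀ i, IsClosed (C i)) (hc : ∀ i, IsPreconnected (C i))
    (hd : Pairwise fun i j => Disjoint (C i) (C j)) {i : ι} {p : X} (hp : p ∈ C i) :
    connectedComponentIn (⋃ j, C j) p = C i := by
  refine (Subset.antisymm ?_ ((hc i).subset_connectedComponentIn hp (subset_iUnion C i)))
  have hcl' : IsClosed (⋃ j ∈ ({i}ᶜ : Set ι), C j) :=
    (toFinite _).isClosed_biUnion fun j _ => hcl j
  have hdj : Disjoint (C i) (⋃ j ∈ ({i}ᶜ : Set ι), C j) :=
    disjoint_iUnion₂_right.2 fun j hj => hd (Ne.symm hj)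
  have hsub : connectedComponentIn (⋃ j, C j) p ⊆ C i ∪ ⋃ j ∈ ({i}ᶜ : Set ι), C j := by
    refine (connectedComponentIn_subset _ _).trans (iUnion_subset fun j => ?_)
    by_cases hj : j = i
    · exact hj ▸ subset_union_left
    · exact (subset_biUnion_of_mem (u := C) hj).trans subset_union_right
  refine (isPreconnected_iff_subset_of_disjoint_closed.1 isPreconnected_connectedComponentIn
    _ _ (hcl i) hcl' hsub (by rw [hdj.inter_eq, inter_empty])).resolve_right fun h => ?_
  exact Set.disjoint_left.1 hdj hp (h (mem_connectedComponentIn (mem_iUnion.2 ⟨i, hp⟩)))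

theorem length_loops : loops.length = 13 := by decide +kernel

/-- The components of the curve. -/
def loopCurve (i : Fin 13) : Set (ℝ × ℝ) := curve (loops[i.1]'(i.2.trans_eq length_loops.symm))

theorem isConnected_loopCurve (i : Fin 13) : IsConnected (loopCurve i) :=
  isConnected_curve (List.getElem_mem _)

theorem pairwise_disjoint_loopCurve :
    Pairwise fun i j => Disjoint (loopCurve i) (loopCurve j) := by
  have h := List.pairwise_iff_getElem.1 (pairwise_disjoint_curve pairwiseApart_loops)
  intro i j hij
  rcases lt_or_gt_of_ne (Fin.val_ne_of_ne hij) with hlt | hlt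
  · exact h _ _ _ _ hlt
  · exact (h _ _ _ _ hlt).symm

theorem iUnion_loopCurve : ⋃ i, loopCurve i = Z := by
  refine Subset.antisymm (iUnion_subset fun i p hp => (mem_curve.1 hp).1) fun p hp => ?_
  obtain ⟨L, hL, hpL⟩ := exists_mem_curve hp
  obtain ⟨i, hi, rfl⟩ := List.getElem_of_mem hL
  exact mem_iUnion.2 ⟨⟨i, hi.trans_eq length_loops⟩, hpL⟩

theorem components_Z : components Z = range loopCurve := by
  have h {i p} (hp : p ∈ loopCurve i) : connectedComponentIn Z p = loopCurve i :=
    iUnion_loopCurve ▸ connectedComponentIn_iUnion (fun _ => isClosed_curve _)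
      (fun i => (isConnected_loopCurve i).isPreconnected) pairwise_disjoint_loopCurve hp
  ext A
  constructor
  · rintro ⟨p, hp, rfl⟩
    obtain ⟨i, hi⟩ := mem_iUnion.1 (iUnion_loopCurve ▸ hp)
    exact ⟨i, (h hi).symm⟩
  · rintro ⟨i, rfl⟩
    obtain ⟨p, hp⟩ := (isConnected_loopCurve i).nonempty
    exact ⟨p, (mem_curve.1 hp).1, (h hp).symm⟩

theorem injective_loopCurve : Function.Injective loopCurve := by
  intro i j hij
  by_contra hne
  obtain ⟨p, hp⟩ := (isConnected_loopCurve i).nonempty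
  exact Set.disjoint_left.1 (pairwise_disjoint_loopCurve hne) hp (hij ▸ hp)

theorem isBounded_loopCurve_iff {i : Fin 13} :
    Bornology.IsBounded (loopCurve i) ↔ i.1 < 11 := by
  have hi : i.1 < loops.length := i.2.trans_eq length_loops.symm
  refine ⟨fun h => ?_, fun h => isBounded_curve ?_⟩
  · by_contra! hlt
    refine not_isBounded_curve ?_ h
    exact List.mem_drop_iff_getElem.2 ⟨i.1 - 11, by omega, by congr 1; omega⟩
  · exact List.mem_take_iff_getElem.2 ⟨i.1, by omega, rfl⟩

theorem ncard_components_of_iff {P : Set (ℝ × ℝ) → Prop} {Q : Fin 13 → Prop} [DecidablePred Q]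
    (h : ∀ i, P (loopCurve i) ↔ Q i) :
    {C ∈ components Z | P C}.ncard = (Finset.univ.filter Q).card := by
  have : {C ∈ components Z | P C} = loopCurve '' ↑(Finset.univ.filter Q) := by
    ext C
    simp only [components_Z, mem_ofPred_eq, mem_range, mem_image, Finset.coe_filter,
      Finset.mem_univ, true_and]
    constructor
    · rintro ⟨⟨i, rfl⟩, hC⟩
      exact ⟨i, (h i).1 hC, rfl⟩
    · rintro ⟨i, hi, rfl⟩
      exact ⟨⟨i, rfl⟩, (h i).2 hi⟩
  rw [this, ncard_image_of_injective _ injective_loopCurve, ncard_coe_finset]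

end

/-- The hessian curve of `f` has exactly 13 connected components: 11 bounded (ovals)
and 2 unbounded. -/
theorem hessian_curve_components :
    (components Z).ncard = 13 ∧
    {C ∈ components Z | Bornology.IsBounded C}.ncard = 11 ∧
    {C ∈ components Z | ¬ Bornology.IsBounded C}.ncard = 2 := by
  refine ⟨?_, ?_, ?_⟩
  · rw [components_Z, ← Set.image_univ, Set.ncard_image_of_injective _ injective_loopCurve,
      Set.ncard_univ, Nat.card_fin]
  · rw [ncard_components_of_iff fun i => isBounded_loopCurve_iff]
    rfl
  · rw [ncard_components_of_iff fun i => isBounded_loopCurve_iff.not]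
    rfl
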